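/- Under Assumptions (EF) and (RO), suppose the martingale selection problem (V,C) with V_t := ri(K_t*) and C_t := −A_t* is solvable. Then there exist F_t-measurable correspondences K̂_t : Ω ⇒ ℝ^d with closed convex cone values such that the market (K̂,A) dominates (K,A) and the martingale selection problem (V̂,C) with V̂_t := ri(K̂_t*) is solvable. -/

import Mathlib

open Set MeasureTheory Pointwise

namespace MSPPaper

section Defs

variable {Ω E : Type*}

/-- A finitely supported probability measure on `Ω`: finite support, strictly
positive weights on the support, total mass one. -/
structure FinProb (Ω : Type*) where
  supp : Finset Ω
  w : Ω → ℝ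
  pos : ∀ ω ∈ supp, 0 < w ω
  zero : ∀ ω ∉ supp, w ω = 0
  sum_one : ∑ ω ∈ supp, w ω = 1

/-- The measure of a set under a finitely supported probability. -/
noncomputable def FinProb.meas (Q : FinProb Ω) (A : Set Ω) : ℝ :=
  letI := Classical.decPred fun ω => ω ∈ A
  ∑ ω ∈ Q.supp.filter (fun ω => ω ∈ A), Q.w ω

/-- The level set `Σ_t^ω` of the process `ψ`. -/
def level (ψ : ℕ → Ω → E) (t : ℕ) (ω : Ω) : Set Ω :=
  {ω' | ∀ s ≤ t, ψ s ω' = ψ s ω}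

/-- The conditional expectation `E_Q[ξ | F_t](ω)`. -/
noncomputable def condExp {F : Type*} [AddCommMonoid F] [Module ℝ F]
    (ψ : ℕ → Ω → E) (t : ℕ) (Q : FinProb Ω) (ξ : Ω → F) (ω : Ω) : F :=
  letI := Classical.decPred fun ω' => ω' ∈ level ψ t ω
  (Q.meas (level ψ t ω))⁻¹ •
    ∑ ω' ∈ Q.supp.filter (fun ω' => ω' ∈ level ψ t ω), Q.w ω' • ξ ω'

variable [MeasurableSpace E]

/-- The natural filtration `F̂_t` generated by `ψ_0, …, ψ_t`. -/
def natFilt (ψ : ℕ → Ω → E) (t : ℕ) : MeasurableSpace Ω :=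
  ⨆ s ∈ Finset.range (t + 1), MeasurableSpace.comap (ψ s) inferInstance

/-- The `P`-null sets relative to `F̂_t`. -/
def nullSets (ψ : ℕ → Ω → E) (P : FinProb Ω) (t : ℕ) : Set (Set Ω) :=
  {A | ∃ A', A ⊆ A' ∧ MeasurableSet[natFilt ψ t] A' ∧ P.meas A' = 0}

/-- The completed filtration `F_t`. -/
def filt (ψ : ℕ → Ω → E) (t : ℕ) : MeasurableSpace Ω :=
  ⨅ P : FinProb Ω,
    MeasurableSpace.generateFrom ({A | MeasurableSet[natFilt ψ t] A} ∪ nullSets ψ P t)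

/-- `G`-measurability of a correspondence. -/
def CorrMeasurable {F : Type*} [TopologicalSpace F]
    (G : MeasurableSpace Ω) (U : Ω → Set F) : Prop :=
  ∀ O : Set F, IsOpen O → MeasurableSet[G] {ω | (U ω ∩ O).Nonempty}

/-- The set `L(G; U)` of `G`-measurable selections of `U`. -/
def Selections {F : Type*} [MeasurableSpace F]
    (G : MeasurableSpace Ω) (U : Ω → Set F) : Set (Ω → F) :=
  {ξ | Measurable[G] ξ ∧ ∀ ω, ξ ω ∈ U ω}

/-- The correspondence `U^♯` (taken at stage `t`). -/
def sharp {d : ℕ} (ψ : ℕ → Ω → E) (t : ℕ) (U : Ω → Set (Fin d → ℝ)) (ω : Ω) :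
    Set (Fin d → ℝ) :=
  convexHull ℝ (⋃ ω' ∈ level ψ t ω, U ω')

/-- The correspondence `U^♭` (taken at stage `t`). -/
def flat {d : ℕ} (ψ : ℕ → Ω → E) (t : ℕ) (U : Ω → Set (Fin d → ℝ)) (ω : Ω) :
    Set (Fin d → ℝ) :=
  ⋂ ω' ∈ level ψ t ω, ⋃ l ∈ Ioo (0 : ℝ) 1, (l • U ω' + (1 - l) • sharp ψ t U ω)

/-- The backward iteration defining `W`, indexed from the terminal date. -/
def Wrev {d : ℕ} (ψ : ℕ → Ω → E) (T : ℕ) (V C : ℕ → Ω → Set (Fin d → ℝ)) :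
    ℕ → Ω → Set (Fin d → ℝ)
  | 0 => V T
  | (k + 1) => fun ω =>
      V (T - (k + 1)) ω ∩
        (flat ψ (T - (k + 1)) (Wrev ψ T V C k) ω - C (T - (k + 1)) ω)

/-- The sequence `W_t`: `W_T = V_T` and `W_t = V_t ∩ (W_{t+1}^♭ − C_t)` for `t < T`. -/
def W {d : ℕ} (ψ : ℕ → Ω → E) (T : ℕ) (V C : ℕ → Ω → Set (Fin d → ℝ)) (t : ℕ) :
    Ω → Set (Fin d → ℝ) :=
  Wrev ψ T V C (T - t)

/-- The defining hypotheses of a martingale selection problem `(V, C)`: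
adapted measurable correspondences, `V_t(ω)` convex and relatively open,
`C_t(ω)` closed and convex. -/
def IsMSP {d : ℕ} (ψ : ℕ → Ω → E) (T : ℕ) (V C : ℕ → Ω → Set (Fin d → ℝ)) : Prop :=
  ∀ t ≤ T,
    CorrMeasurable (filt ψ t) (V t) ∧ CorrMeasurable (filt ψ t) (C t) ∧
    ∀ ω : Ω, Convex ℝ (V t ω) ∧ V t ω = intrinsicInterior ℝ (V t ω) ∧
      IsClosed (C t ω) ∧ Convex ℝ (C t ω)

/-- `(ξ, Q)` is a solution of the martingale selection problem `(V, C)`. -/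
def IsSolution {d : ℕ} (ψ : ℕ → Ω → E) (T : ℕ) (V C : ℕ → Ω → Set (Fin d → ℝ))
    (ξ : ℕ → Ω → (Fin d → ℝ)) (Q : FinProb Ω) : Prop :=
  (∀ t ≤ T, ξ t ∈ Selections (filt ψ t) (V t)) ∧
  (∀ t, t + 1 ≤ T → ∀ ω ∈ Q.supp, condExp ψ t Q (ξ (t + 1)) ω - ξ t ω ∈ C t ω)

/-- Solvability of the martingale selection problem: a local solution exists at
every point of `Ω`. -/
def Solvable {d : ℕ} (ψ : ℕ → Ω → E) (T : ℕ) (V C : ℕ → Ω → Set (Fin d → ℝ)) : Prop :=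
  ∀ ωb : Ω, ∃ (ξ : ℕ → Ω → (Fin d → ℝ)) (Q : FinProb Ω),
    ωb ∈ Q.supp ∧ IsSolution ψ T V C ξ Q

/-- The positive polar cone of a subset of `ℝ^d`. -/
def polar {d : ℕ} (B : Set (Fin d → ℝ)) : Set (Fin d → ℝ) :=
  {y | ∀ x ∈ B, 0 ≤ ∑ i, y i * x i}

/-- A closed convex cone (containing the origin). -/
def IsClosedConvexCone {F : Type*} [TopologicalSpace F] [AddCommMonoid F] [Module ℝ F]
    (A : Set F) : Prop :=
  IsClosed A ∧ Convex ℝ A ∧ (0 : F) ∈ A ∧ ∀ c : ℝ, 0 < c → ∀ x ∈ A, c • x ∈ A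

end Defs

section KabanovDefs

variable {Ω E : Type*} [MeasurableSpace E]

/-- Admissible (self-financing, constrained) strategies in the Kabanov model,
with the convention `h_{-1} = 0`. -/
def Admissible {d : ℕ} (ψ : ℕ → Ω → E) (T : ℕ) (K A : ℕ → Ω → Set (Fin d → ℝ))
    (h : ℕ → Ω → (Fin d → ℝ)) : Prop :=
  (∀ t ≤ T, h t ∈ Selections (filt ψ t) (A t)) ∧
  (∀ ω, -h 0 ω ∈ K 0 ω) ∧
  (∀ t, t + 1 ≤ T → ∀ ω, h t ω - h (t + 1) ω ∈ K (t + 1) ω)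

/-- An arbitrage strategy in the Kabanov model. -/
def IsArbitrage {d : ℕ} (ψ : ℕ → Ω → E) (T : ℕ) (K A : ℕ → Ω → Set (Fin d → ℝ))
    (h : ℕ → Ω → (Fin d → ℝ)) : Prop :=
  Admissible ψ T K A h ∧ (∀ ω, ∀ i, 0 ≤ h T ω i) ∧ ∃ ω, h T ω ≠ 0

/-- Weak no-arbitrage `NA^w` for the market `(K, A)`. -/
def NAw {d : ℕ} (ψ : ℕ → Ω → E) (T : ℕ) (K A : ℕ → Ω → Set (Fin d → ℝ)) : Prop :=
  ¬ ∃ h : ℕ → Ω → (Fin d → ℝ), IsArbitrage ψ T K A h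

/-- The cone `Khat` dominates the cone `K0`. -/
def ConeDominates {d : ℕ} (K0 Khat : Set (Fin d → ℝ)) : Prop :=
  K0 \ (K0 ∩ -K0) ⊆ intrinsicInterior ℝ Khat

/-- The market `(Khat, A)` dominates the market `(K, A)`. -/
def MarketDominates {d : ℕ} (T : ℕ) (Khat K : ℕ → Ω → Set (Fin d → ℝ)) : Prop :=
  ∀ t ≤ T, ∀ ω : Ω, ConeDominates (K t ω) (Khat t ω)

/-- Robust no-arbitrage `NA^r`: some dominating market satisfies `NA^w`. -/
def NAr {d : ℕ} (ψ : ℕ → Ω → E) (T : ℕ) (K A : ℕ → Ω → Set (Fin d → ℝ)) : Prop :=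
  ∃ Khat : ℕ → Ω → Set (Fin d → ℝ),
    (∀ t ≤ T, CorrMeasurable (filt ψ t) (Khat t)) ∧
    (∀ t ≤ T, ∀ ω, IsClosedConvexCone (Khat t ω)) ∧
    MarketDominates T Khat K ∧ NAw ψ T Khat A

/-- Assumption (EF): free disposal and availability of a nonzero nonnegative
admissible position. -/
def AssumptionEF {d : ℕ} (T : ℕ) (K A : ℕ → Ω → Set (Fin d → ℝ)) : Prop :=
  ∀ t ≤ T, ∀ ω : Ω,
    ({x : Fin d → ℝ | (∀ i, 0 ≤ x i) ∧ x ≠ 0} ⊆ interior (K t ω)) ∧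
    ∃ x ∈ A t ω, (∀ i, 0 ≤ x i) ∧ x ≠ 0

/-- Assumption (RO): either no constraints, or efficient friction. -/
def AssumptionRO {d : ℕ} (T : ℕ) (K A : ℕ → Ω → Set (Fin d → ℝ)) : Prop :=
  (∀ t ≤ T, ∀ ω : Ω, A t ω = Set.univ) ∨
  (∀ t ≤ T, ∀ ω : Ω, K t ω ∩ -K t ω = {0})

/-- Solvability of the martingale selection problem `(V, C)` (spelled out). -/
def MSPSolvable {d : ℕ} (ψ : ℕ → Ω → E) (T : ℕ)
    (V C : ℕ → Ω → Set (Fin d → ℝ)) : Prop :=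
  ∀ ωb : Ω, ∃ (ξ : ℕ → Ω → (Fin d → ℝ)) (Q : FinProb Ω), ωb ∈ Q.supp ∧
    (∀ t ≤ T, ξ t ∈ Selections (filt ψ t) (V t)) ∧
    (∀ t, t + 1 ≤ T → ∀ ω ∈ Q.supp, condExp ψ t Q (ξ (t + 1)) ω - ξ t ω ∈ C t ω)

end KabanovDefs

section AlgebraicCore

variable {F : Type*} [AddCommGroup F] [Module ℝ F]

/-- The algebraic relative interior of `B`: the points of `B` from which every segment of `B`
ending there can be prolonged inside `B`. -/
def algCore (B : Set F) : Set F :=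
  {y | y ∈ B ∧ ∀ z ∈ B, ∃ δ : ℝ, 0 < δ ∧ y + δ • (y - z) ∈ B}

theorem algCore_subset (B : Set F) : algCore B ⊆ B := fun _ h => h.1

theorem mem_openSegment_add_smul_sub {y z : F} {δ : ℝ} (hδ : 0 < δ) :
    y ∈ openSegment ℝ z (y + δ • (y - z)) := by
  refine ⟨δ / (1 + δ), 1 / (1 + δ), by positivity, by positivity, by field_simp; ring, ?_⟩
  match_scalars <;> field_simp
  ring

theorem exists_add_smul_sub_of_mem_openSegment {y z y' : F} (h : y ∈ openSegment ℝ z y') :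
    ∃ δ : ℝ, 0 < δ ∧ y + δ • (y - z) = y' := by
  obtain ⟨a, b, ha, hb, hab, rfl⟩ := h
  refine ⟨a / b, by positivity, ?_⟩
  obtain rfl : a = 1 - b := by linarith
  match_scalars <;> field_simp <;> ring

theorem exists_mem_openSegment_of_mem_algCore {B : Set F} {y z : F} (hy : y ∈ algCore B)
    (hz : z ∈ B) : ∃ y' ∈ B, y ∈ openSegment ℝ z y' := by
  obtain ⟨δ, hδ, h⟩ := hy.2 z hz
  exact ⟨_, h, mem_openSegment_add_smul_sub hδ⟩

theorem mem_algCore_of_openSegment {B : Set F} {y : F} (hy : y ∈ B)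
    (h : ∀ z ∈ B, ∃ y' ∈ B, y ∈ openSegment ℝ z y') : y ∈ algCore B := by
  refine ⟨hy, fun z hz => ?_⟩
  obtain ⟨y', hy', hs⟩ := h z hz
  obtain ⟨δ, hδ, rfl⟩ := exists_add_smul_sub_of_mem_openSegment hs
  exact ⟨δ, hδ, hy'⟩

theorem _root_.Convex.exists_mem_openSegment_trans {M : Set F} (hM : Convex ℝ M) {y y₁ y₂ ζ m : F}
    (hm : m ∈ M) (hy₂ : y₂ ∈ M) (h : y ∈ openSegment ℝ y₁ y₂) (h₁ : y₁ ∈ openSegment ℝ ζ m) :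
    ∃ m' ∈ M, y ∈ openSegment ℝ ζ m' := by
  obtain ⟨p, q, hp, hq, hpq, rfl⟩ := h
  obtain ⟨a, b, ha, hb, hab, rfl⟩ := h₁
  refine ⟨(p * b / (p * b + q)) • m + (q / (p * b + q)) • y₂,
    hM hm hy₂ (by positivity) (by positivity) (by field_simp),
    p * a, p * b + q, by positivity, by positivity, by linear_combination p * hab + hpq, ?_⟩
  match_scalars <;> field_simp

theorem openSegment_subset_algCore {B : Set F} (hB : Convex ℝ B) {c b : F} (hc : c ∈ algCore B)
    (hb : b ∈ B) : openSegment ℝ c b ⊆ algCore B := by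
  intro y hy
  refine mem_algCore_of_openSegment (hB.openSegment_subset hc.1 hb hy) fun z hz => ?_
  obtain ⟨c', hc', hs⟩ := exists_mem_openSegment_of_mem_algCore hc hz
  exact hB.exists_mem_openSegment_trans hc' hb hy hs

theorem convex_algCore {B : Set F} (hB : Convex ℝ B) : Convex ℝ (algCore B) :=
  convex_iff_openSegment_subset.2 fun _ hx _ hy => openSegment_subset_algCore hB hx hy.1

theorem algCore_algCore {B : Set F} (hB : Convex ℝ B) : algCore (algCore B) = algCore B := by
  refine (algCore_subset _).antisymm fun y hy => mem_algCore_of_openSegment hy fun z hz => ?_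
  obtain ⟨δ, hδ, h⟩ := hy.2 z hz.1
  refine ⟨y + (δ / 2) • (y - z), openSegment_subset_algCore hB hy h ?_,
    mem_openSegment_add_smul_sub (by positivity)⟩
  refine ⟨1 / 2, 1 / 2, by positivity, by positivity, by norm_num, ?_⟩
  match_scalars <;> ring

theorem _root_.Convex.add_smul_mem_of_le {B : Set F} (hB : Convex ℝ B) {y v : F} {δ δ' : ℝ}
    (hy : y ∈ B) (h : y + δ • v ∈ B) (h0 : 0 ≤ δ') (hle : δ' ≤ δ) : y + δ' • v ∈ B := by
  rcases h0.eq_or_lt with rfl | h0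
  · simpa using hy
  have hδ : 0 < δ := h0.trans_le hle
  have := hB.add_smul_mem hy h (t := δ' / δ) ⟨by positivity, (div_le_one hδ).2 hle⟩
  rwa [smul_smul, div_mul_cancel₀ _ hδ.ne'] at this

/-- If every element of a set of directions can be followed both ways from `y` inside the convex
set `B`, so can every direction in their span. -/
theorem _root_.Convex.exists_add_smul_mem_of_mem_span {B : Set F} (hB : Convex ℝ B) {y : F}
    (hy : y ∈ B) {G : Set F} (hG : ∀ v ∈ G, ∃ δ : ℝ, 0 < δ ∧ y + δ • v ∈ B ∧ y - δ • v ∈ B) {v : F}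
    (hv : v ∈ Submodule.span ℝ G) : ∃ δ : ℝ, 0 < δ ∧ y + δ • v ∈ B ∧ y - δ • v ∈ B := by
  induction hv using Submodule.span_induction with
  | mem v hv => exact hG v hv
  | zero => exact ⟨1, one_pos, by simpa, by simpa⟩
  | add v w _ _ hv hw =>
    obtain ⟨δ, hδ, h1, h2⟩ := hv
    obtain ⟨ε, hε, h3, h4⟩ := hw
    rw [sub_eq_add_neg, ← smul_neg] at h2 h4
    have hm : 0 < min δ ε := lt_min hδ hε
    have k1 := hB.add_smul_mem_of_le hy h1 hm.le (min_le_left _ _)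
    have k2 := hB.add_smul_mem_of_le hy h2 hm.le (min_le_left _ _)
    have k3 := hB.add_smul_mem_of_le hy h3 hm.le (min_le_right _ _)
    have k4 := hB.add_smul_mem_of_le hy h4 hm.le (min_le_right _ _)
    refine ⟨min δ ε / 2, by positivity, ?_, ?_⟩
    · convert hB k1 k3 (a := 1 / 2) (b := 1 / 2) (by norm_num) (by norm_num) (by norm_num) using 1
      match_scalars <;> ring
    · convert hB k2 k4 (a := 1 / 2) (b := 1 / 2) (by norm_num) (by norm_num) (by norm_num) using 1
      match_scalars <;> ring
  | smul a v _ hv =>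
    obtain ⟨δ, hδ, h1, h2⟩ := hv
    rcases lt_trichotomy a 0 with ha | rfl | ha
    · have e : (δ / (-a)) • a • v = -(δ • v) := by
        rw [smul_smul, ← neg_smul, div_mul_eq_mul_div, mul_div_assoc, div_neg, div_self ha.ne]; simp
      refine ⟨δ / (-a), div_pos hδ (by linarith), ?_, ?_⟩
      · rwa [e, ← sub_eq_add_neg]
      · rwa [e, sub_neg_eq_add]
    · exact ⟨1, one_pos, by simpa, by simpa⟩
    · have e : (δ / a) • a • v = δ • v := by rw [smul_smul]; congr 1; field_simp
      exact ⟨δ / a, by positivity, by rwa [e], by rwa [e]⟩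

variable [FiniteDimensional ℝ F]

/-- A point of the algebraic core of a convex hull lies in the core of the hull of finitely many
of the generators, in directions pointing to any generator. -/
theorem exists_finite_of_mem_algCore_convexHull {S : Set F} {y : F}
    (hy : y ∈ algCore (convexHull ℝ S)) :
    ∃ P : Set F, P.Finite ∧ P ⊆ S ∧ y ∈ convexHull ℝ P ∧
      ∀ v ∈ Submodule.span ℝ ((fun s => y - s) '' S), ∃ δ : ℝ, 0 < δ ∧
        y + δ • v ∈ convexHull ℝ P := by
  obtain ⟨s, hsS, hspan⟩ := (Submodule.fg_span_iff_fg_span_finset_subset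
    ((fun s => y - s) '' S)).1
    (IsNoetherian.noetherian (R := ℝ) (M := F) _)
  have hfin : ∀ z ∈ convexHull ℝ S, ∃ P : Set F, P.Finite ∧ P ⊆ S ∧ z ∈ convexHull ℝ P := by
    intro z hz
    rw [convexHull_eq_union_convexHull_finite_subsets] at hz
    simp only [mem_iUnion] at hz
    obtain ⟨t, ht, h⟩ := hz
    exact ⟨t, t.finite_toSet, ht, h⟩
  obtain ⟨P₀, hP₀, hP₀S, hyP₀⟩ := hfin y hy.1
  have hloc : ∀ v : s, ∃ P : Set F, P.Finite ∧ P ⊆ S ∧ ∃ δ : ℝ, 0 < δ ∧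
      y + δ • (v : F) ∈ convexHull ℝ P ∧ y - (v : F) ∈ P := by
    rintro ⟨v, hv⟩
    obtain ⟨z, hz, rfl⟩ := hsS hv
    obtain ⟨δ, hδ, h⟩ := hy.2 z (subset_convexHull ℝ S hz)
    obtain ⟨P, hP, hPS, hm⟩ := hfin _ h
    exact ⟨insert z P, hP.insert z, insert_subset hz hPS, δ, hδ,
      convexHull_mono (subset_insert _ _) hm, by simp⟩
  choose P hP hPS δ hδ hm hm' using hloc
  have hyP : y ∈ convexHull ℝ (P₀ ∪ ⋃ v, P v) := convexHull_mono subset_union_left hyP₀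
  have hsub : ∀ v, P v ⊆ P₀ ∪ ⋃ v, P v := fun v =>
    (subset_iUnion P v).trans subset_union_right
  refine ⟨P₀ ∪ ⋃ v, P v, hP₀.union (finite_iUnion hP), union_subset hP₀S (iUnion_subset hPS),
    hyP, fun v hv => ?_⟩
  rw [hspan] at hv
  have hdir : ∀ v ∈ (s : Set F), ∃ δ : ℝ, 0 < δ ∧
      y + δ • v ∈ convexHull ℝ (P₀ ∪ ⋃ v, P v) ∧ y - δ • v ∈ convexHull ℝ (P₀ ∪ ⋃ v, P v) := by
    intro v hv
    have h1 := convexHull_mono (hsub ⟨v, hv⟩) (hm ⟨v, hv⟩)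
    have h2 := subset_convexHull ℝ _ (hsub ⟨v, hv⟩ (hm' ⟨v, hv⟩))
    have hpos := hδ ⟨v, hv⟩
    refine ⟨min (δ ⟨v, hv⟩) 1, lt_min hpos one_pos,
      (convex_convexHull ℝ _).add_smul_mem_of_le hyP h1 (by positivity) (min_le_left _ _), ?_⟩
    rw [sub_eq_add_neg, ← smul_neg]
    refine (convex_convexHull ℝ _).add_smul_mem_of_le hyP (δ := 1) ?_ (by positivity)
      (min_le_right _ _)
    simpa [sub_eq_add_neg] using h2
  obtain ⟨ε, hε, h, -⟩ :=
    (convex_convexHull ℝ _).exists_add_smul_mem_of_mem_span hyP hdir hv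
  exact ⟨ε, hε, h⟩

end AlgebraicCore

section IntrinsicInterior

variable {F : Type*} [NormedAddCommGroup F] [NormedSpace ℝ F]

theorem mem_intrinsicInterior_iff_dist {X : Set F} {y : F} :
    y ∈ intrinsicInterior ℝ X ↔
      y ∈ X ∧ ∃ ε > 0, ∀ p ∈ affineSpan ℝ X, dist p y < ε → p ∈ X := by
  rw [mem_intrinsicInterior]
  constructor
  · rintro ⟨y, hy, rfl⟩
    refine ⟨interior_subset (s := ((↑) ⁻¹' X : Set (affineSpan ℝ X))) hy, ?_⟩
    rw [mem_interior_iff_mem_nhds, Metric.mem_nhds_iff] at hy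
    obtain ⟨ε, hε, h⟩ := hy
    exact ⟨ε, hε, fun p hp hd => h (show (⟨p, hp⟩ : affineSpan ℝ X) ∈ Metric.ball y ε from hd)⟩
  · rintro ⟨hy, ε, hε, h⟩
    refine ⟨⟨y, subset_affineSpan ℝ X hy⟩, ?_, rfl⟩
    rw [mem_interior_iff_mem_nhds, Metric.mem_nhds_iff]
    exact ⟨ε, hε, fun p hp => h p p.2 hp⟩

theorem intrinsicInterior_subset_algCore (X : Set F) : intrinsicInterior ℝ X ⊆ algCore X := by
  intro y hy
  obtain ⟨hyX, ε, hε, h⟩ := mem_intrinsicInterior_iff_dist.1 hy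
  refine ⟨hyX, fun z hz => ?_⟩
  refine ⟨ε / (‖y - z‖ + 1), by positivity, h _ ?_ ?_⟩
  · have := AffineMap.lineMap_mem (-(ε / (‖y - z‖ + 1))) (subset_affineSpan ℝ X hyX)
      (subset_affineSpan ℝ X hz)
    convert this using 1
    rw [AffineMap.lineMap_apply_module]
    module
  · rw [dist_self_add_left, norm_smul, Real.norm_of_nonneg (by positivity), div_mul_eq_mul_div,
      div_lt_iff₀ (by positivity)]
    nlinarith [norm_nonneg (y - z)]

theorem _root_.Convex.intrinsicInterior_eq_algCore [FiniteDimensional ℝ F] {X : Set F}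
    (hX : Convex ℝ X) : intrinsicInterior ℝ X = algCore X := by
  refine (intrinsicInterior_subset_algCore X).antisymm fun y hy => ?_
  obtain ⟨r, hr⟩ := Set.Nonempty.intrinsicInterior hX ⟨y, hy.1⟩
  obtain ⟨hrX, ε, hε, h⟩ := mem_intrinsicInterior_iff_dist.1 hr
  obtain ⟨y', hy', a, b, ha, hb, hab, rfl⟩ := exists_mem_openSegment_of_mem_algCore hy hrX
  refine mem_intrinsicInterior_iff_dist.2 ⟨hy.1, a * ε, by positivity, fun p hp hd => ?_⟩
  have hq : r + a⁻¹ • (p - (a • r + b • y')) ∈ X := by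
    refine h _ ?_ ?_
    · have := AffineSubspace.smul_vsub_vadd_mem _ a⁻¹ hp (subset_affineSpan ℝ X hy.1)
        (subset_affineSpan ℝ X hrX)
      simpa [add_comm] using this
    · rw [dist_self_add_left, norm_smul, norm_inv, Real.norm_of_nonneg ha.le, ← dist_eq_norm,
        inv_mul_lt_iff₀ ha]
      exact hd
  convert hX hq hy' ha.le hb.le hab using 1
  match_scalars <;> field_simp <;> ring

theorem algCore_nonempty [FiniteDimensional ℝ F] {X : Set F} (hX : Convex ℝ X)
    (hne : X.Nonempty) : (algCore X).Nonempty :=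
  (Set.Nonempty.intrinsicInterior hX hne).mono (intrinsicInterior_subset_algCore X)

/-- A point of the algebraic core of a convex set stays in the core of any convex subset that is
radially dense. -/
theorem mem_algCore_of_forall_openSegment_subset [FiniteDimensional ℝ F] {X B : Set F} {y : F}
    (hy : y ∈ algCore X) (hB : Convex ℝ B) (hBX : B ⊆ X)
    (hd : ∀ f ∈ X, ∃ b ∈ B, openSegment ℝ f b ⊆ B) : y ∈ algCore B := by
  obtain ⟨b', hb', -⟩ := hd y hy.1
  obtain ⟨b₀, hb₀⟩ := algCore_nonempty hB ⟨b', hb'⟩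
  obtain ⟨y', hy', hs⟩ := exists_mem_openSegment_of_mem_algCore hy (hBX hb₀.1)
  obtain ⟨b, hb, hsub⟩ := hd y' hy'
  rw [← algCore_algCore hB] at hb₀
  have hb₁ : ∃ b₁ ∈ algCore B, b₀ ∈ openSegment ℝ b b₁ := by
    rw [algCore_algCore hB] at hb₀
    obtain ⟨δ, hδ, h⟩ := hb₀.2 b hb
    refine ⟨b₀ + (δ / 2) • (b₀ - b), openSegment_subset_algCore hB hb₀ h ?_,
      mem_openSegment_add_smul_sub (by positivity)⟩
    refine ⟨1 / 2, 1 / 2, by positivity, by positivity, by norm_num, ?_⟩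
    match_scalars <;> ring
  obtain ⟨b₁, hb₁, r, s, hr, hs', hrs, rfl⟩ := hb₁
  obtain ⟨p, q, hp, hq, hpq, rfl⟩ := hs
  have hq₀ : (q / (q + p * r)) • y' + (p * r / (q + p * r)) • b ∈ B :=
    hsub ⟨_, _, by positivity, by positivity, by field_simp, rfl⟩
  refine openSegment_subset_algCore hB hb₁ hq₀
    ⟨p * s, q + p * r, by positivity, by positivity, by linear_combination p * hrs + hpq, ?_⟩
  match_scalars <;> field_simp

end IntrinsicInterior

section Cones

variable {d : ℕ}

theorem isClosedConvexCone_polar (B : Set (Fin d → ℝ)) : IsClosedConvexCone (polar B) := by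
  refine ⟨?_, ?_, ?_, ?_⟩
  · have : polar B = ⋂ x ∈ B, {y : Fin d → ℝ | 0 ≤ ∑ i, y i * x i} := by
      ext y; simp [polar]
    rw [this]
    exact isClosed_biInter fun x _ => isClosed_le continuous_const (by fun_prop)
  · intro y hy z hz a b ha hb _ x hx
    have : ∑ i, (a • y + b • z) i * x i = a * ∑ i, y i * x i + b * ∑ i, z i * x i := by
      simp only [Finset.mul_sum, ← Finset.sum_add_distrib, Pi.add_apply, Pi.smul_apply,
        smul_eq_mul]
      exact Finset.sum_congr rfl fun i _ => by ring
    rw [this]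
    have := hy x hx
    have := hz x hx
    positivity
  · intro x _
    simp
  · intro c hc y hy x hx
    have : ∑ i, (c • y) i * x i = c * ∑ i, y i * x i := by
      simp only [Finset.mul_sum, Pi.smul_apply, smul_eq_mul]
      exact Finset.sum_congr rfl fun i _ => by ring
    rw [this]
    have := hy x hx
    positivity

theorem subset_polar_polar (B : Set (Fin d → ℝ)) : B ⊆ polar (polar B) := fun x hx y hy => by
  simpa only [mul_comm] using hy x hx

/-- The bipolar theorem: a point that is nonnegative on the polar of a closed convex cone belongs
to the cone. -/
theorem IsClosedConvexCone.polar_polar_subset {K : Set (Fin d → ℝ)} (hK : IsClosedConvexCone K) :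
    polar (polar K) ⊆ K := by
  intro x hx
  by_contra hxK
  obtain ⟨f, u, hfx, hfK⟩ := geometric_hahn_banach_point_closed hK.2.1 hK.1 hxK
  have hf : ∀ z, f z = ∑ i, f (Pi.single i 1) * z i := by
    intro z
    conv_lhs => rw [pi_eq_sum_univ' z]
    simp [mul_comm]
  have hu : u < 0 := by simpa using hfK 0 hK.2.2.1
  have hpol : (fun i => f (Pi.single i 1)) ∈ polar K := by
    intro z hz
    rw [← hf]
    by_contra! hneg
    have h := hfK _ (hK.2.2.2 (u / f z) (div_pos_of_neg_of_neg hu hneg) z hz)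
    rw [map_smul, smul_eq_mul, div_mul_cancel₀ _ hneg.ne] at h
    exact lt_irrefl _ h
  have := hx _ hpol
  have h := hf x
  simp only [mul_comm] at this h
  linarith

theorem polar_polar_subset_span (B : Set (Fin d → ℝ)) :
    polar (polar B) ⊆ Submodule.span ℝ B := by
  intro z hz
  by_contra hzB
  obtain ⟨f, hfz, hfB⟩ := Submodule.exists_le_ker_of_notMem hzB
  have hf : ∀ z, f z = ∑ i, f (Pi.single i 1) * z i := by
    intro z
    conv_lhs => rw [pi_eq_sum_univ' z]
    simp [mul_comm]
  have h0 : ∀ x ∈ B, f x = 0 := fun x hx => hfB (Submodule.subset_span hx)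
  have h1 : (fun i => f (Pi.single i 1)) ∈ polar B := by
    intro x hx
    rw [← hf, h0 x hx]
  have h2 : (fun i => -f (Pi.single i 1)) ∈ polar B := by
    intro x hx
    simp only [neg_mul, Finset.sum_neg_distrib]
    rw [← hf, h0 x hx, neg_zero]
  have k1 := hz _ h1
  have k2 := hz _ h2
  simp only [mul_comm (z _), neg_mul, Finset.sum_neg_distrib] at k1 k2
  rw [← hf] at k1 k2
  exact hfz (by linarith)

/-- Finitely many points of the relative interior of the polar of a closed convex cone remain in
the relative interior of the polar of some dominating cone. -/
theorem exists_coneDominates {K D : Set (Fin d → ℝ)} (hK : IsClosedConvexCone K)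
    (hD : D.Finite) (hDK : D ⊆ intrinsicInterior ℝ (polar K)) :
    ∃ Khat, IsClosedConvexCone Khat ∧ ConeDominates K Khat ∧
      D ⊆ intrinsicInterior ℝ (polar Khat) := by
  have hX := (isClosedConvexCone_polar K).2.1
  have hXs := (isClosedConvexCone_polar K).2.2.2
  rw [hX.intrinsicInterior_eq_algCore] at hDK
  have hS : Convex ℝ (algCore (polar K)) := convex_algCore hX
  have hSs : ∀ y ∈ algCore (polar K), (2 : ℝ) • y ∈ algCore (polar K) := by
    intro y hy
    refine ⟨hXs 2 two_pos y hy.1, fun z hz => ?_⟩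
    obtain ⟨δ, hδ, h⟩ := hy.2 _ (hXs (1 / 2) (by norm_num) z hz)
    refine ⟨δ, hδ, ?_⟩
    convert hXs 2 two_pos _ h using 1
    match_scalars <;> ring
  have hfin : ∀ y : D, ∃ P : Set (Fin d → ℝ), P.Finite ∧ P ⊆ algCore (polar K) ∧
      ∀ v ∈ Submodule.span ℝ (algCore (polar K)), ∃ δ : ℝ, 0 < δ ∧
        (y : Fin d → ℝ) + δ • v ∈ convexHull ℝ P := by
    rintro ⟨y, hy⟩
    have hy' := hDK hy
    rw [← algCore_algCore hX, ← hS.convexHull_eq] at hy'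
    obtain ⟨P, hP, hPS, -, h⟩ := exists_finite_of_mem_algCore_convexHull hy'
    refine ⟨P, hP, hPS, fun v hv => h v (Submodule.span_le.2 ?_ hv)⟩
    have h2 : y ∈ Submodule.span ℝ ((fun s => y - s) '' algCore (polar K)) := by
      have := Submodule.subset_span (R := ℝ)
        (mem_image_of_mem (fun s => y - s) (hSs y (hDK hy)))
      rw [two_smul] at this
      simpa using Submodule.neg_mem _ this
    intro s hs
    have := Submodule.sub_mem _ h2 (Submodule.subset_span (R := ℝ)
      (mem_image_of_mem (fun s => y - s) hs))
    simpa using this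
  choose P hP hPS h using hfin
  have : Finite D := hD
  set D' := D ∪ ⋃ y, P y with hD'
  have hD'fin : D'.Finite := hD.union (finite_iUnion hP)
  have hD'S : D' ⊆ algCore (polar K) := union_subset hDK (iUnion_subset hPS)
  refine ⟨polar D', isClosedConvexCone_polar D', fun x hx => ?_, fun y hy => ?_⟩
  · refine interior_subset_intrinsicInterior (mem_interior.2
      ⟨⋂ y ∈ D', {x | 0 < ∑ i, x i * y i}, fun z hz y hy => (mem_iInter₂.1 hz y hy).le,
        hD'fin.isOpen_biInter fun y _ => isOpen_lt continuous_const (by fun_prop),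
        mem_iInter₂.2 fun y hy => ?_⟩)
    have hyS := hD'S hy
    have hnn : 0 ≤ ∑ i, x i * y i := by simpa only [mul_comm] using hyS.1 x hx.1
    refine hnn.lt_of_ne fun h0 => hx.2 ⟨hx.1, ?_⟩
    refine hK.polar_polar_subset fun z hz => ?_
    obtain ⟨δ, hδ, hm⟩ := hyS.2 z hz
    have hm := hm x hx.1
    have e : ∑ i, (y + δ • (y - z)) i * x i
        = (1 + δ) * ∑ i, x i * y i + δ * ∑ i, (-x) i * z i := by
      simp only [Finset.mul_sum, ← Finset.sum_add_distrib, Pi.add_apply, Pi.smul_apply,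
        Pi.sub_apply, Pi.neg_apply, smul_eq_mul]
      exact Finset.sum_congr rfl fun i _ => by ring
    rw [e, ← h0, mul_zero, zero_add] at hm
    exact nonneg_of_mul_nonneg_right hm hδ
  · have hX' := (isClosedConvexCone_polar (polar D')).2.1
    rw [hX'.intrinsicInterior_eq_algCore]
    refine ⟨subset_polar_polar D' (subset_union_left hy), fun z hz => ?_⟩
    have hz := Submodule.span_mono hD'S (polar_polar_subset_span D' hz)
    obtain ⟨δ, hδ, hm⟩ := h ⟨y, hy⟩ (y - z)
      (Submodule.sub_mem _ (Submodule.subset_span (hDK hy)) hz)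
    refine ⟨δ, hδ, convexHull_min ?_ hX' hm⟩
    exact ((subset_iUnion P _).trans subset_union_right).trans (subset_polar_polar D')

end Cones

section Trees

variable {Ω F : Type*} [NormedAddCommGroup F] [NormedSpace ℝ F] [FiniteDimensional ℝ F]

/-- Suppose that `x` can be moved along `C`, for each `ω ∈ L`, into the convex hull of the sets
`G` giving positive weight to `G ω`. Then there are a single move and finitely many points that
serve all `ω ∈ L` simultaneously, using only points lying in `G ω'` for all `ω'` in the same cell
`s ω` of a partition. -/
theorem exists_common_move {G : Ω → Set F} {L : Set Ω} {s : Ω → Set Ω}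
    (hL : L.Nonempty) (hrefl : ∀ ω, ω ∈ s ω) (hsub : ∀ ω ∈ L, s ω ⊆ L)
    (hcell : ∀ ω, ∀ ω' ∈ s ω, s ω' = s ω)
    (habs : ∀ ω, ∀ ω' ∈ s ω, ∀ x ∈ G ω, ∀ u ∈ G ω', openSegment ℝ x u ⊆ G ω)
    {C : Set F} (hC : Convex ℝ C) {x : F}
    (hx : ∀ ω ∈ L, ∃ c ∈ C, ∃ ζ ∈ G ω, ∃ m ∈ convexHull ℝ (⋃ ω' ∈ L, G ω'),
      x + c ∈ openSegment ℝ ζ m) :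
    ∃ c ∈ C, ∃ P : Set F, P.Finite ∧ P ⊆ ⋃ ω ∈ L, ⋂ ω' ∈ s ω, G ω' ∧
      ∀ ω ∈ L, ∃ z ∈ ⋂ ω' ∈ s ω, G ω', ∃ m ∈ convexHull ℝ P, x + c ∈ openSegment ℝ z m := by
  set S : Set F := ⋃ ω' ∈ L, G ω' with hSdef
  set M := convexHull ℝ S with hMdef
  have hM : Convex ℝ M := convex_convexHull ℝ S
  have hGM : ∀ ω ∈ L, G ω ⊆ M := fun ω hω =>
    (subset_biUnion_of_mem (u := fun ω => G ω) hω).trans (subset_convexHull ℝ S)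
  set N : Set F := {y | y ∈ M ∧ y - x ∈ C} with hNdef
  have hN : Convex ℝ N := by
    intro y hy z hz a b ha hb hab
    refine ⟨hM hy.1 hz.1 ha hb hab, ?_⟩
    convert hC hy.2 hz.2 ha hb hab using 1
    obtain rfl : a = 1 - b := by linarith
    module
  have hxN : ∀ ω ∈ L, ∃ y ∈ N, ∃ ζ ∈ G ω, ∃ m ∈ M, y ∈ openSegment ℝ ζ m := by
    intro ω hω
    obtain ⟨c, hc, ζ, hζ, m, hm, h⟩ := hx ω hω
    exact ⟨x + c, ⟨hM.openSegment_subset (hGM ω hω hζ) hm h, by simpa⟩, ζ, hζ, m, hm, h⟩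
  have hNne : N.Nonempty := by
    obtain ⟨ω, hω⟩ := hL
    obtain ⟨y, hy, -⟩ := hxN ω hω
    exact ⟨y, hy⟩
  obtain ⟨y, hy⟩ := algCore_nonempty hN hNne
  have hyM : y ∈ M := hy.1.1
  have hyG : ∀ ω ∈ L, ∃ ζ ∈ G ω, ∃ m ∈ M, y ∈ openSegment ℝ ζ m := by
    intro ω hω
    obtain ⟨y₁, hy₁, ζ, hζ, m, hm, h₁⟩ := hxN ω hω
    obtain ⟨y₂, hy₂, h⟩ := exists_mem_openSegment_of_mem_algCore hy hy₁
    exact ⟨ζ, hζ, hM.exists_mem_openSegment_trans hm hy₂.1 h h₁⟩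
  -- the smallest face of `M` containing `y`
  set Φ : Set F := {f | f ∈ M ∧ ∃ δ : ℝ, 0 < δ ∧ y + δ • (y - f) ∈ M} with hΦdef
  have hΦ : Convex ℝ Φ := by
    rintro f ⟨hf, δ, hδ, hfδ⟩ g ⟨hg, ε, hε, hgε⟩ a b ha hb hab
    refine ⟨hM hf hg ha hb hab, min δ ε, lt_min hδ hε, ?_⟩
    have h1 := hM.add_smul_mem_of_le hyM hfδ (lt_min hδ hε).le (min_le_left _ _)
    have h2 := hM.add_smul_mem_of_le hyM hgε (lt_min hδ hε).le (min_le_right _ _)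
    convert hM h1 h2 ha hb hab using 1
    obtain rfl : a = 1 - b := by linarith
    module
  have hΦ_of : ∀ f ∈ M, ∀ m ∈ M, y ∈ openSegment ℝ f m → f ∈ Φ := by
    intro f hf m hm h
    obtain ⟨δ, hδ, rfl⟩ := exists_add_smul_sub_of_mem_openSegment h
    exact ⟨hf, δ, hδ, hm⟩
  have hyΦ : y ∈ algCore Φ := by
    refine mem_algCore_of_openSegment ⟨hyM, 1, one_pos, by simpa⟩ ?_
    rintro f ⟨hf, δ, hδ, hm⟩
    have h := mem_openSegment_add_smul_sub (y := y) (z := f) hδ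
    exact ⟨_, hΦ_of _ hm f hf (openSegment_symm ℝ f _ ▸ h), h⟩
  have hface : ∀ f ∈ M, ∀ g ∈ M, ∀ m ∈ openSegment ℝ f g, m ∈ Φ → f ∈ Φ := by
    rintro f hf g hg m hm ⟨-, δ, hδ, h⟩
    obtain ⟨m', hm', h'⟩ := hM.exists_mem_openSegment_trans hg h
      (mem_openSegment_add_smul_sub hδ) hm
    exact hΦ_of f hf m' hm' h'
  have hΦS : Φ ⊆ convexHull ℝ (Φ ∩ S) := by
    have key : M ⊆ {m | m ∈ M ∧ (m ∈ Φ → m ∈ convexHull ℝ (Φ ∩ S))} := by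
      refine convexHull_min (fun m hm => ⟨subset_convexHull ℝ S hm,
        fun h => subset_convexHull ℝ _ ⟨h, hm⟩⟩) (convex_iff_openSegment_subset.2 ?_)
      rintro f ⟨hfM, hf⟩ g ⟨hgM, hg⟩ m hm
      refine ⟨hM.openSegment_subset hfM hgM hm, fun hmΦ => ?_⟩
      exact (convex_convexHull ℝ _).openSegment_subset (hf (hface f hfM g hgM m hm hmΦ))
        (hg (hface g hgM f hfM m (openSegment_symm ℝ f g ▸ hm) hmΦ)) hm
    exact fun f hf => (key hf.1).2 hf
  set Z : Ω → Set F := fun ω => Φ ∩ ⋃ ω' ∈ s ω, G ω' with hZdef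
  have hZ : ∀ ω, Convex ℝ (Z ω) := by
    refine fun ω => hΦ.inter (convex_iff_openSegment_subset.2 fun u hu v hv => ?_)
    simp only [mem_iUnion, exists_prop] at hu hv
    obtain ⟨ω₁, h₁, hu⟩ := hu
    obtain ⟨ω₂, h₂, hv⟩ := hv
    refine (habs ω₁ ω₂ (hcell ω ω₁ h₁ ▸ h₂) u hu v hv).trans ?_
    exact subset_biUnion_of_mem (u := fun ω => G ω) h₁
  have hGZ : ∀ ω ∈ L, ∀ ω' ∈ s ω, ∃ ζ ∈ G ω', ζ ∈ Z ω := by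
    intro ω hω ω' hω'
    obtain ⟨ζ, hζ, m, hm, h⟩ := hyG ω' (hsub ω hω hω')
    exact ⟨ζ, hζ, hΦ_of ζ (hGM ω' (hsub ω hω hω') hζ) m hm h, mem_biUnion hω' hζ⟩
  have hZne : ∀ ω ∈ L, (algCore (Z ω)).Nonempty := by
    intro ω hω
    obtain ⟨ζ, -, hζ⟩ := hGZ ω hω ω (hrefl ω)
    exact algCore_nonempty (hZ ω) ⟨ζ, hζ⟩
  have hZG : ∀ ω ∈ L, algCore (Z ω) ⊆ ⋂ ω' ∈ s ω, G ω' := by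
    intro ω hω w hw
    refine mem_iInter₂.2 fun ω' hω' => ?_
    obtain ⟨ζ, hζ, hζZ⟩ := hGZ ω hω ω' hω'
    obtain ⟨u, ⟨-, hu⟩, h⟩ := exists_mem_openSegment_of_mem_algCore hw hζZ
    simp only [mem_iUnion, exists_prop] at hu
    obtain ⟨ω'', h'', hu⟩ := hu
    exact habs ω' ω'' (hcell ω ω' hω' ▸ h'') ζ hζ u hu h
  set S' : Set F := ⋃ ω ∈ L, algCore (Z ω) with hS'def
  have hZS' : ∀ ω ∈ L, algCore (Z ω) ⊆ convexHull ℝ S' := fun ω hω =>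
    (subset_biUnion_of_mem (u := fun ω => algCore (Z ω)) hω).trans (subset_convexHull ℝ S')
  have hB : Convex ℝ (convexHull ℝ S') := convex_convexHull ℝ S'
  have hyB : y ∈ algCore (convexHull ℝ S') := by
    refine mem_algCore_of_forall_openSegment_subset hyΦ hB
      (convexHull_min (iUnion₂_subset fun ω _ w hw => hw.1.1) hΦ) ?_
    have key : convexHull ℝ (Φ ∩ S) ⊆
        {f | ∃ b ∈ convexHull ℝ S', openSegment ℝ f b ⊆ convexHull ℝ S'} := by
      refine convexHull_min ?_ ?_
      · rintro f ⟨hfΦ, hf⟩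
        simp only [hSdef, mem_iUnion, exists_prop] at hf
        obtain ⟨ω, hω, hf⟩ := hf
        obtain ⟨b, hb⟩ := hZne ω hω
        refine ⟨b, hZS' ω hω hb, ?_⟩
        rw [openSegment_symm]
        exact (openSegment_subset_algCore (hZ ω) hb ⟨hfΦ, mem_biUnion (hrefl ω) hf⟩).trans
          (hZS' ω hω)
      · rintro f ⟨b, hb, hfb⟩ g ⟨c, hc, hgc⟩ p q hp hq hpq
        refine ⟨p • b + q • c, hB hb hc hp hq hpq, ?_⟩
        rintro _ ⟨a₁, a₂, h₁, h₂, h, rfl⟩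
        convert hB (hfb ⟨a₁, a₂, h₁, h₂, h, rfl⟩) (hgc ⟨a₁, a₂, h₁, h₂, h, rfl⟩) hp hq hpq using 1
        module
    exact fun f hf => key (hΦS hf)
  obtain ⟨P, hP, hPS, -, h⟩ := exists_finite_of_mem_algCore_convexHull hyB
  refine ⟨y - x, hy.1.2, P, hP, hPS.trans (iUnion₂_mono hZG), fun ω hω => ?_⟩
  obtain ⟨z, hz⟩ := hZne ω hω
  obtain ⟨δ, hδ, hm⟩ := h (y - z) (Submodule.subset_span
    (mem_image_of_mem _ (mem_biUnion hω hz)))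
  refine ⟨z, hZG ω hω hz, _, hm, ?_⟩
  rw [add_sub_cancel]
  exact mem_openSegment_add_smul_sub hδ

end Trees

section Merging

variable {Ω F : Type*} [AddCommGroup F] [Module ℝ F]

/-- A convex combination of points of the sets `G` can be regrouped so that at most one point per
cell of the partition `s` is used. -/
theorem exists_grouped_combination {G : Ω → Set F} {L : Set Ω} {s : Ω → Set Ω}
    (hrefl : ∀ ω, ω ∈ s ω) (hcell : ∀ ω, ∀ ω' ∈ s ω, s ω' = s ω)
    (habs : ∀ ω, ∀ ω' ∈ s ω, ∀ x ∈ G ω, ∀ u ∈ G ω', openSegment ℝ x u ⊆ G ω)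
    {ω : Ω} (hω : ω ∈ L) {ζ m y : F} (hζ : ζ ∈ G ω) (hm : m ∈ convexHull ℝ (⋃ ω' ∈ L, G ω'))
    (hy : y ∈ openSegment ℝ ζ m) :
    ∃ (R : Finset Ω) (ν : Ω → ℝ) (v : Ω → F), ω ∈ R ∧ (∀ r ∈ R, r ∈ L) ∧
      (∀ r ∈ R, ∀ r' ∈ R, r' ∈ s r → r' = r) ∧ (∀ r ∈ R, 0 < ν r) ∧ ∑ r ∈ R, ν r = 1 ∧
      (∀ r ∈ R, v r ∈ G r) ∧ ∑ r ∈ R, ν r • v r = y := by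
  classical
  set Y : Set F := {y | ∃ (R : Finset Ω) (ν : Ω → ℝ) (v : Ω → F), ω ∈ R ∧ (∀ r ∈ R, r ∈ L) ∧
      (∀ r ∈ R, ∀ r' ∈ R, r' ∈ s r → r' = r) ∧ (∀ r ∈ R, 0 < ν r) ∧ ∑ r ∈ R, ν r = 1 ∧
      (∀ r ∈ R, v r ∈ G r) ∧ ∑ r ∈ R, ν r • v r = y} with hY
  have habsorb : ∀ y ∈ Y, ∀ ω' ∈ L, ∀ u ∈ G ω', openSegment ℝ y u ⊆ Y := by
    rintro y ⟨R, ν, v, hωR, hRL, hRs, hν, hν1, hv, rfl⟩ ω' hω' u hu _ ⟨a, b, ha, hb, hab, rfl⟩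
    by_cases h : ∃ r ∈ R, ω' ∈ s r
    · obtain ⟨r, hr, hrω⟩ := h
      have hνr := hν r hr
      refine ⟨R, fun k => a * ν k + if k = r then b else 0, Function.update v r
        ((a * ν r / (a * ν r + b)) • v r + (b / (a * ν r + b)) • u), hωR, hRL, hRs, ?_, ?_, ?_, ?_⟩
      · intro k hk
        have := hν k hk
        show 0 < a * ν k + if k = r then b else 0
        split_ifs <;> positivity
      · rw [Finset.sum_add_distrib, ← Finset.mul_sum, hν1, Finset.sum_ite_eq' R r, if_pos hr]
        linarith
      · intro k hk
        rcases eq_or_ne k r with rfl | hkr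
        · rw [Function.update_self]
          exact habs k ω' hrω _ (hv k hk) u hu
            ⟨_, _, by positivity, by positivity, by field_simp, rfl⟩
        · rw [Function.update_of_ne hkr]
          exact hv k hk
      · have : ∀ k ∈ R, (a * ν k + if k = r then b else 0) • Function.update v r
            ((a * ν r / (a * ν r + b)) • v r + (b / (a * ν r + b)) • u) k
            = a • ν k • v k + if k = r then b • u else 0 := by
          intro k hk
          rcases eq_or_ne k r with rfl | hkr
          · rw [Function.update_self, if_pos rfl, if_pos rfl]
            match_scalars <;> field_simp
          · rw [Function.update_of_ne hkr, if_neg hkr, if_neg hkr, add_zero, add_zero, mul_smul]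
        rw [Finset.sum_congr rfl this, Finset.sum_add_distrib, ← Finset.smul_sum,
          Finset.sum_ite_eq' R r, if_pos hr]
    · push Not at h
      have hω'R : ω' ∉ R := fun hR => h ω' hR (hrefl ω')
      have hne : ∀ k ∈ R, k ≠ ω' := fun k hk hkω => hω'R (hkω ▸ hk)
      refine ⟨insert ω' R, Function.update (fun k => a * ν k) ω' b, Function.update v ω' u,
        Finset.mem_insert_of_mem hωR, ?_, ?_, ?_, ?_, ?_, ?_⟩
      · intro r hr
        rcases Finset.mem_insert.1 hr with rfl | hr
        exacts [hω', hRL r hr]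
      · intro r hr r' hr' hrr'
        rcases Finset.mem_insert.1 hr with h₁ | h₁ <;>
          rcases Finset.mem_insert.1 hr' with h₂ | h₂
        · exact h₂.trans h₁.symm
        · exact absurd (hcell _ _ hrr' ▸ h₁ ▸ hrefl r) (h r' h₂)
        · exact absurd (h₂ ▸ hrr') (h r h₁)
        · exact hRs r h₁ r' h₂ hrr'
      · intro r hr
        rcases Finset.mem_insert.1 hr with rfl | hr
        · rwa [Function.update_self]
        · rw [Function.update_of_ne (hne r hr)]
          exact mul_pos ha (hν r hr)
      · rw [Finset.sum_insert hω'R, Function.update_self, Finset.sum_congr rfl fun k hk =>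
          Function.update_of_ne (hne k hk) _ _, ← Finset.mul_sum, hν1]
        linarith
      · intro r hr
        rcases Finset.mem_insert.1 hr with rfl | hr
        · rwa [Function.update_self]
        · rw [Function.update_of_ne (hne r hr)]
          exact hv r hr
      · rw [Finset.sum_insert hω'R, Function.update_self, Function.update_self,
          Finset.sum_congr rfl fun k hk => by
            rw [Function.update_of_ne (hne k hk), Function.update_of_ne (hne k hk), mul_smul],
          ← Finset.smul_sum, add_comm]
  have hhull : convexHull ℝ (⋃ ω' ∈ L, G ω') ⊆ {m | ∀ y ∈ Y, openSegment ℝ y m ⊆ Y} := by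
    refine convexHull_min (fun u hu y hy => ?_) (convex_iff_openSegment_subset.2 ?_)
    · simp only [mem_iUnion, exists_prop] at hu
      obtain ⟨ω', hω', hu⟩ := hu
      exact habsorb y hy ω' hω' u hu
    · rintro m hm m' hm' _ ⟨p, q, hp, hq, hpq, rfl⟩ y hy _ ⟨a, b, ha, hb, hab, rfl⟩
      have h₁ : (a / (a + b * p)) • y + (b * p / (a + b * p)) • m ∈ Y :=
        hm y hy ⟨_, _, by positivity, by positivity, by field_simp, rfl⟩
      refine hm' _ h₁ ⟨a + b * p, b * q, by positivity, by positivity,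
        by linear_combination b * hpq + hab, ?_⟩
      match_scalars <;> field_simp
  refine hhull hm ζ ⟨{ω}, fun _ => 1, fun _ => ζ, ?_⟩ hy
  simp [hω, hζ]

/-- A weighted mean with positive weights gives positive weight to each of its points. -/
theorem exists_weighted_mean_mem_openSegment {S : Finset Ω} {w : Ω → ℝ} {z : Ω → F}
    (hw : ∀ i ∈ S, 0 < w i) {i : Ω} (hi : i ∈ S) :
    ∃ m ∈ convexHull ℝ (z '' S),
      (∑ j ∈ S, w j)⁻¹ • ∑ j ∈ S, w j • z j ∈ openSegment ℝ (z i) m := by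
  classical
  have hwi := hw i hi
  have hR : 0 ≤ ∑ j ∈ S.erase i, w j :=
    Finset.sum_nonneg fun j hj => (hw j (Finset.mem_of_mem_erase hj)).le
  have hsum : ∀ b : ℝ, ∑ j ∈ S, Function.update w i b j = b + ∑ j ∈ S.erase i, w j := by
    intro b
    rw [← Finset.add_sum_erase S _ hi, Function.update_self, Finset.sum_congr rfl fun k hk =>
      Function.update_of_ne (Finset.ne_of_mem_erase hk) _ _]
  have hsum' : ∀ b : ℝ, ∑ j ∈ S, Function.update w i b j • z j
      = b • z i + ∑ j ∈ S.erase i, w j • z j := by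
    intro b
    rw [← Finset.add_sum_erase S _ hi, Function.update_self, Finset.sum_congr rfl fun k hk => by
      rw [Function.update_of_ne (Finset.ne_of_mem_erase hk)]]
  have hmem : S.centerMass (Function.update w i (w i / 2)) z ∈ convexHull ℝ (z '' S) := by
    refine Finset.centerMass_mem_convexHull S (fun j hj => ?_) ?_
      fun j hj => mem_image_of_mem z hj
    · rcases eq_or_ne j i with rfl | h
      · rw [Function.update_self]; positivity
      · rw [Function.update_of_ne h]; exact (hw j hj).le
    · rw [hsum]; positivity
  refine ⟨_, hmem, ?_⟩
  rw [Finset.centerMass, hsum, hsum', ← Finset.add_sum_erase S w hi,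
    ← Finset.add_sum_erase S (fun j => w j • z j) hi]
  generalize ∑ j ∈ S.erase i, w j = R at *
  refine ⟨(w i / 2) / (w i + R), (w i / 2 + R) / (w i + R), by positivity, by positivity,
    by field_simp; ring, ?_⟩
  match_scalars
  · field_simp; ring
  · field_simp

end Merging

section Filtration

variable {Ω E : Type*}

theorem FinProb.nonneg (Q : FinProb Ω) (ω : Ω) : 0 ≤ Q.w ω := by
  by_cases h : ω ∈ Q.supp
  exacts [(Q.pos ω h).le, (Q.zero ω h).ge]

theorem FinProb.mem_supp_iff (Q : FinProb Ω) {ω : Ω} : ω ∈ Q.supp ↔ Q.w ω ≠ 0 :=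
  ⟨fun h => (Q.pos ω h).ne', fun h => by_contra fun k => h (Q.zero ω k)⟩

open Classical in
/-- The Dirac measure at a point. -/
noncomputable def FinProb.dirac (ω : Ω) : FinProb Ω where
  supp := {ω}
  w := Pi.single ω 1
  pos := by simp
  zero := fun ω' h => Pi.single_eq_of_ne (by simpa using h) _
  sum_one := by simp

theorem mem_level_self (ψ : ℕ → Ω → E) (t : ℕ) (ω : Ω) : ω ∈ level ψ t ω := fun _ _ => rfl

theorem level_eq_of_mem {ψ : ℕ → Ω → E} {t : ℕ} {ω ω' : Ω} (h : ω' ∈ level ψ t ω) :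
    level ψ t ω' = level ψ t ω := by
  ext ω''
  exact ⟨fun k s hs => (k s hs).trans (h s hs), fun k s hs => (k s hs).trans (h s hs).symm⟩

theorem mem_level_symm {ψ : ℕ → Ω → E} {t : ℕ} {ω ω' : Ω} (h : ω' ∈ level ψ t ω) :
    ω ∈ level ψ t ω' := level_eq_of_mem h ▸ mem_level_self ψ t ω

theorem level_antitone (ψ : ℕ → Ω → E) (ω : Ω) : Antitone fun t => level ψ t ω :=
  fun _ _ hst _ h r hr => h r (hr.trans hst)

variable [MeasurableSpace E]

theorem mem_iff_mem_of_measurableSet_natFilt {ψ : ℕ → Ω → E} {t : ℕ} {B : Set Ω}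
    (hB : MeasurableSet[natFilt ψ t] B) {ω ω' : Ω} (h : ω' ∈ level ψ t ω) :
    ω' ∈ B ↔ ω ∈ B := by
  let m : MeasurableSpace Ω :=
    { MeasurableSet' := fun B => ω' ∈ B ↔ ω ∈ B
      measurableSet_empty := Iff.rfl
      measurableSet_compl := fun _ h => not_congr h
      measurableSet_iUnion := fun f h => by simp only [mem_iUnion, h] }
  have hle : natFilt ψ t ≤ m := by
    refine iSup₂_le fun s hs => ?_
    rintro _ ⟨A, -, rfl⟩
    change ψ s ω' ∈ A ↔ ψ s ω ∈ A
    rw [h s (by simpa [Nat.lt_succ_iff] using hs)]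
  exact hle B hB

theorem mem_iff_mem_of_measurableSet_filt {ψ : ℕ → Ω → E} {t : ℕ} {B : Set Ω}
    (hB : MeasurableSet[filt ψ t] B) {ω ω' : Ω} (h : ω' ∈ level ψ t ω) :
    ω' ∈ B ↔ ω ∈ B := by
  classical
  let m : MeasurableSpace Ω :=
    { MeasurableSet' := fun B => ω' ∈ B ↔ ω ∈ B
      measurableSet_empty := Iff.rfl
      measurableSet_compl := fun _ h => not_congr h
      measurableSet_iUnion := fun f h => by simp only [mem_iUnion, h] }
  have hle : filt ψ t ≤ m := by
    refine (iInf_le _ (FinProb.dirac ω)).trans (MeasurableSpace.generateFrom_le ?_)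
    rintro A (hA | ⟨A', hAA', hA', h0⟩)
    · exact mem_iff_mem_of_measurableSet_natFilt hA h
    · have hω : ω ∉ A' := by
        intro hω
        have : (FinProb.dirac ω).meas A' = 1 := by
          simp [FinProb.meas, FinProb.dirac, Finset.filter_singleton, hω]
        linarith
      have hω' : ω' ∉ A' := fun h' => hω ((mem_iff_mem_of_measurableSet_natFilt hA' h).1 h')
      exact ⟨fun k => absurd (hAA' k) hω', fun k => absurd (hAA' k) hω⟩
  exact hle B hB

theorem measurableSet_natFilt_level [MeasurableSingletonClass E] (ψ : ℕ → Ω → E) (t : ℕ)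
    (ω : Ω) : MeasurableSet[natFilt ψ t] (level ψ t ω) := by
  have : level ψ t ω = ⋂ s ∈ Finset.range (t + 1), ψ s ⁻¹' {ψ s ω} := by
    ext ω'; simp [level]
  rw [this]
  refine Finset.measurableSet_biInter _ fun s hs => ?_
  exact le_iSup₂ (f := fun s (_ : s ∈ Finset.range (t + 1)) =>
    MeasurableSpace.comap (ψ s) inferInstance) s hs _ ⟨_, measurableSet_singleton _, rfl⟩

theorem measurableSet_filt_of_saturated [MeasurableSingletonClass E] {ψ : ℕ → Ω → E} {t : ℕ}
    {B : Set Ω} (hB : ∀ ω ∈ B, level ψ t ω ⊆ B) : MeasurableSet[filt ψ t] B := by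
  classical
  rw [filt, MeasurableSpace.measurableSet_iInf]
  intro P
  set L : Set Ω := ⋃ ω ∈ P.supp, level ψ t ω with hL
  have hLm : MeasurableSet[natFilt ψ t] L :=
    Finset.measurableSet_biUnion _ fun ω _ => measurableSet_natFilt_level ψ t ω
  have e : B = (⋃ ω ∈ P.supp.filter (· ∈ B), level ψ t ω) ∪ B \ L := by
    ext ω
    constructor
    · intro hω
      by_cases hωL : ω ∈ L
      · simp only [hL, mem_iUnion, exists_prop] at hωL
        obtain ⟨ω', hω', h⟩ := hωL
        refine Or.inl (mem_biUnion (Finset.mem_filter.2 ⟨hω', hB ω hω (mem_level_symm h)⟩) h)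
      · exact Or.inr ⟨hω, hωL⟩
    · rintro (h | h)
      · simp only [mem_iUnion, exists_prop, Finset.mem_filter] at h
        obtain ⟨ω', ⟨-, h1⟩, h2⟩ := h
        exact hB ω' h1 h2
      · exact h.1
  rw [e]
  refine @MeasurableSet.union _ (_) _ _ ?_ ?_
  · exact MeasurableSpace.measurableSet_generateFrom (Or.inl
      (Finset.measurableSet_biUnion _ fun ω _ => measurableSet_natFilt_level ψ t ω))
  · refine MeasurableSpace.measurableSet_generateFrom (Or.inr ⟨Lᶜ, fun ω h => h.2,
      hLm.compl, ?_⟩)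
    unfold FinProb.meas
    refine Finset.sum_eq_zero fun ω hω => ?_
    obtain ⟨h, h'⟩ := (@Finset.mem_filter _ _ (_) _ _).1 hω
    exact absurd (mem_biUnion h (mem_level_self ψ t ω)) h'

theorem corrMeasurable_filt_of_const [MeasurableSingletonClass E] {F : Type*}
    [TopologicalSpace F] {ψ : ℕ → Ω → E} {t : ℕ} {U : Ω → Set F}
    (hU : ∀ ω, ∀ ω' ∈ level ψ t ω, U ω' = U ω) : CorrMeasurable (filt ψ t) U := fun O _ =>
  measurableSet_filt_of_saturated fun ω hω ω' hω' => by
    change (U ω' ∩ O).Nonempty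
    rw [hU ω ω' hω']
    exact hω

theorem eq_of_corrMeasurable_filt {F : Type*} [TopologicalSpace F] {ψ : ℕ → Ω → E} {t : ℕ}
    {U : Ω → Set F} (hU : CorrMeasurable (filt ψ t) U) (hcl : ∀ ω, IsClosed (U ω))
    {ω ω' : Ω} (h : ω' ∈ level ψ t ω) : U ω' = U ω := by
  have key : ∀ O : Set F, IsOpen O → ((U ω' ∩ O).Nonempty ↔ (U ω ∩ O).Nonempty) := fun O hO =>
    mem_iff_mem_of_measurableSet_filt (hU O hO) h
  apply Subset.antisymm
  · intro x hx
    by_contra hn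
    obtain ⟨y, hy, hy'⟩ := (key _ (hcl ω).isOpen_compl).1 ⟨x, hx, hn⟩
    exact hy' hy
  · intro x hx
    by_contra hn
    obtain ⟨y, hy, hy'⟩ := (key _ (hcl ω').isOpen_compl).2 ⟨x, hx, hn⟩
    exact hy' hy

end Filtration

section Reach

variable {Ω E F : Type*} [AddCommGroup F] [Module ℝ F]

/-- The points of `V t ω` from which a martingale selection can be continued for `n` periods
along the constraints `C`. -/
def reach (ψ : ℕ → Ω → E) (V C : ℕ → Ω → Set F) : ℕ → ℕ → Ω → Set F
  | 0, t, ω => V t ω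
  | n + 1, t, ω => {x | x ∈ V t ω ∧ ∃ c ∈ C t ω, ∃ ζ ∈ reach ψ V C n (t + 1) ω,
      ∃ m ∈ convexHull ℝ (⋃ ω' ∈ level ψ t ω, reach ψ V C n (t + 1) ω'), x + c ∈ openSegment ℝ ζ m}

variable {ψ : ℕ → Ω → E} {V C : ℕ → Ω → Set F}

theorem reach_subset (n t : ℕ) (ω : Ω) : reach ψ V C n t ω ⊆ V t ω := by
  cases n with
  | zero => exact subset_rfl
  | succ n => exact fun _ h => h.1

theorem openSegment_subset_reach {n t : ℕ} {ω ω' : Ω} (hV : Convex ℝ (V t ω))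
    (hC : Convex ℝ (C t ω)) (hω' : ω' ∈ level ψ t ω) (hVω : V t ω' = V t ω)
    (hCω : C t ω' = C t ω) {x u : F} (hx : x ∈ reach ψ V C n t ω) (hu : u ∈ reach ψ V C n t ω') :
    openSegment ℝ x u ⊆ reach ψ V C n t ω := by
  cases n with
  | zero => exact hV.openSegment_subset hx (hVω.subset hu)
  | succ n =>
    obtain ⟨hxV, c, hc, ζ, hζ, m, hm, h⟩ := hx
    obtain ⟨huV, c', hc', ζ', hζ', m', hm', h'⟩ := hu
    rw [hVω] at huV
    rw [hCω] at hc'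
    rw [level_eq_of_mem hω'] at hm'
    have hconv := convex_convexHull ℝ (⋃ ω' ∈ level ψ t ω, reach ψ V C n (t + 1) ω')
    have hu : u + c' ∈ convexHull ℝ (⋃ ω' ∈ level ψ t ω, reach ψ V C n (t + 1) ω') :=
      hconv.openSegment_subset (subset_convexHull ℝ _ (mem_biUnion hω' hζ')) hm' h'
    rintro y hy
    refine ⟨hV.openSegment_subset hxV huV hy, ?_⟩
    obtain ⟨a, b, ha, hb, hab, rfl⟩ := hy
    obtain ⟨m'', hm'', h''⟩ := hconv.exists_mem_openSegment_trans hm hu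
      ⟨a, b, ha, hb, hab, rfl⟩ h
    refine ⟨a • c + b • c', hC hc hc' ha.le hb.le hab, ζ, hζ, m'', hm'', ?_⟩
    convert h'' using 1
    module

theorem mem_reach_of_solution {T : ℕ} {Q : FinProb Ω} {ξ : ℕ → Ω → F}
    (hξ : ∀ s ≤ T, ∀ ω, ξ s ω ∈ V s ω)
    (hC : ∀ s, s + 1 ≤ T → ∀ ω ∈ Q.supp, condExp ψ s Q (ξ (s + 1)) ω - ξ s ω ∈ C s ω)
    {n t : ℕ} (hnt : n + t = T) {ω : Ω} (hω : ω ∈ Q.supp) : ξ t ω ∈ reach ψ V C n t ω := by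
  classical
  induction n generalizing t ω with
  | zero => exact hξ t (by omega) ω
  | succ n ih =>
    refine ⟨hξ t (by omega) ω, _, hC t (by omega) ω hω, ξ (t + 1) ω, ih (by omega) hω, ?_⟩
    obtain ⟨m, hm, h⟩ := exists_weighted_mean_mem_openSegment
      (S := Q.supp.filter (· ∈ level ψ t ω)) (w := Q.w) (z := ξ (t + 1))
      (fun i hi => Q.pos i (Finset.mem_filter.1 hi).1)
      (Finset.mem_filter.2 ⟨hω, mem_level_self ψ t ω⟩)
    refine ⟨m, convexHull_mono ?_ hm, ?_⟩
    · rintro _ ⟨ω', hω', rfl⟩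
      obtain ⟨h1, h2⟩ := Finset.mem_filter.1 hω'
      exact mem_biUnion h2 (ih (by omega) h1)
    · rw [add_sub_cancel, condExp, FinProb.meas]
      convert h

theorem exists_level_const_selection {X : Type*} (ψ : ℕ → Ω → E) (t : ℕ) {U : Ω → Set X}
    (hU : ∀ ω, ∀ ω' ∈ level ψ t ω, U ω' = U ω) (hne : ∀ ω, (U ω).Nonempty) :
    ∃ f : Ω → X, (∀ ω, f ω ∈ U ω) ∧ ∀ ω, ∀ ω' ∈ level ψ t ω, f ω' = f ω := by
  let rep : Ω → Ω := fun ω => (Quotient.mk (Setoid.ker (level ψ t)) ω).out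
  have hrep : ∀ ω, rep ω ∈ level ψ t ω := fun ω => by
    have h : level ψ t (rep ω) = level ψ t ω :=
      Quotient.mk_out (s := Setoid.ker (level ψ t)) ω
    exact h ▸ mem_level_self ψ t (rep ω)
  refine ⟨fun ω => (hne (rep ω)).some, fun ω => ?_, fun ω ω' h => ?_⟩
  · rw [← hU ω _ (hrep ω)]
    exact (hne (rep ω)).some_mem
  · have : rep ω' = rep ω := congrArg Quotient.out
      (Quotient.sound (s := Setoid.ker (level ψ t)) (level_eq_of_mem h))
    simp only [this]

/-- The finite family `D` is enough to reach `x`: the starting point `x` is reachable on the level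
set of `ω₀` for every correspondence containing `D`. -/
def SupportsReach (ψ : ℕ → Ω → E) (V C : ℕ → Ω → Set F) (T n t : ℕ) (ω₀ : Ω) (x : F)
    (D : ℕ → Ω → Set F) : Prop :=
  (∀ s ω, (D s ω).Finite) ∧ (∀ s, t ≤ s → s ≤ T → ∀ ω, D s ω ⊆ V s ω) ∧
  (∀ s, t ≤ s → ∀ ω, ∀ ω' ∈ level ψ s ω, D s ω' = D s ω) ∧
  ∀ Vhat : ℕ → Ω → Set F, (∀ s, t ≤ s → s ≤ T → ∀ ω ∈ level ψ t ω₀, D s ω ⊆ Vhat s ω) →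
    ∀ ω ∈ level ψ t ω₀, x ∈ reach ψ Vhat C n t ω

theorem mem_level_iff_of_mem {s t : ℕ} (hts : t ≤ s) {ω₀ ω ω' : Ω} (h : ω' ∈ level ψ s ω) :
    ω' ∈ level ψ t ω₀ ↔ ω ∈ level ψ t ω₀ := by
  have h' := level_antitone ψ ω hts h
  constructor <;> intro k
  · exact level_eq_of_mem k ▸ mem_level_symm h'
  · exact level_eq_of_mem k ▸ h'

end Reach

section SupportsReach

variable {Ω E F : Type*} [NormedAddCommGroup F] [NormedSpace ℝ F] [FiniteDimensional ℝ F]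

theorem exists_supportsReach {ψ : ℕ → Ω → E} {V C : ℕ → Ω → Set F} {T : ℕ}
    (hV : ∀ t ≤ T, ∀ ω, Convex ℝ (V t ω)) (hC : ∀ t ≤ T, ∀ ω, Convex ℝ (C t ω))
    (hVc : ∀ t ≤ T, ∀ ω, ∀ ω' ∈ level ψ t ω, V t ω' = V t ω)
    (hCc : ∀ t ≤ T, ∀ ω, ∀ ω' ∈ level ψ t ω, C t ω' = C t ω)
    {n t : ℕ} (hnt : n + t = T) {ω₀ : Ω} {x : F}
    (hx : ∀ ω ∈ level ψ t ω₀, x ∈ reach ψ V C n t ω) :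
    ∃ D, SupportsReach ψ V C T n t ω₀ x D := by
  induction n generalizing t ω₀ x with
  | zero =>
    refine ⟨fun s ω => {y | s = t ∧ ω ∈ level ψ t ω₀ ∧ y = x}, fun s ω =>
      (finite_singleton x).subset fun y h => h.2.2, ?_, ?_, ?_⟩
    · rintro s - - ω y ⟨rfl, hω, rfl⟩
      exact hx ω hω
    · intro s hs ω ω' h
      simp only [mem_level_iff_of_mem hs h]
    · exact fun Vhat h ω hω => h t le_rfl (by omega) ω hω ⟨rfl, hω, rfl⟩
  | succ n ih =>
    set L := level ψ t ω₀ with hL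
    have hsub : ∀ ω ∈ L, level ψ (t + 1) ω ⊆ L := fun ω hω ω' h =>
      (mem_level_iff_of_mem t.le_succ h).2 hω
    obtain ⟨c, hc, P, hP, hPG, hz⟩ := exists_common_move (G := reach ψ V C n (t + 1)) (L := L)
      (s := level ψ (t + 1)) ⟨ω₀, mem_level_self ψ t ω₀⟩ (mem_level_self ψ (t + 1)) hsub
      (fun _ _ => level_eq_of_mem)
      (fun ω ω' h _ hx _ hu => openSegment_subset_reach (hV _ (by omega) ω) (hC _ (by omega) ω) h
        (hVc _ (by omega) ω ω' h) (hCc _ (by omega) ω ω' h) hx hu)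
      (hC t (by omega) ω₀) (x := x) fun ω hω => by
        obtain ⟨-, h⟩ := hx ω hω
        rwa [level_eq_of_mem hω, hCc t (by omega) ω₀ ω hω] at h
    have hp : ∀ p, ∃ ω D, p ∈ P → ω ∈ L ∧ SupportsReach ψ V C T n (t + 1) ω p D := by
      intro p
      by_cases h : p ∈ P
      · have := hPG h
        simp only [mem_iUnion, mem_iInter, exists_prop] at this
        obtain ⟨ω, hω, h⟩ := this
        obtain ⟨D, hD⟩ := ih (by omega) h
        exact ⟨ω, D, fun _ => ⟨hω, hD⟩⟩
      · exact ⟨ω₀, fun _ _ => ∅, fun k => absurd k h⟩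
    have hz' : ∀ ω, ∃ z D, ω ∈ L → (∃ m ∈ convexHull ℝ P, x + c ∈ openSegment ℝ z m) ∧
        SupportsReach ψ V C T n (t + 1) ω z D := by
      intro ω
      by_cases hω : ω ∈ L
      · obtain ⟨z, hzG, hm⟩ := hz ω hω
        obtain ⟨D, hD⟩ := ih (by omega) (mem_iInter₂.1 hzG)
        exact ⟨z, D, fun _ => ⟨hm, hD⟩⟩
      · exact ⟨0, fun _ _ => ∅, fun k => absurd k hω⟩
    choose ωP DP hDP using hp
    choose z Dz hDz using hz'
    obtain ⟨rep, hrep, hrepc⟩ := exists_level_const_selection ψ (t + 1)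
      (fun _ _ => level_eq_of_mem) fun ω => ⟨ω, mem_level_self ψ (t + 1) ω⟩
    have hrepL : ∀ ω ∈ L, rep ω ∈ L := fun ω hω => hsub ω hω (hrep ω)
    refine ⟨fun s ω => {y | s = t ∧ ω ∈ L ∧ y = x} ∪ {y | t + 1 ≤ s ∧
      ((∃ p ∈ P, y ∈ DP p s ω) ∨ (ω ∈ L ∧ y ∈ Dz (rep ω) s ω))}, fun s ω => ?_, ?_, ?_, ?_⟩
    · refine ((finite_singleton x).subset fun y h => h.2.2).union ?_
      have h1 : (⋃ p ∈ P, DP p s ω).Finite := hP.biUnion fun p hp => (hDP p hp).2.1 s ω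
      have h2 : {y | ω ∈ L ∧ y ∈ Dz (rep ω) s ω}.Finite := by
        by_cases hω : ω ∈ L
        · exact ((hDz _ (hrepL ω hω)).2.1 s ω).subset fun y h => h.2
        · exact finite_empty.subset fun y h => hω h.1
      refine (h1.union h2).subset ?_
      rintro y ⟨-, ⟨p, hp, h⟩ | h⟩
      exacts [Or.inl (mem_biUnion hp h), Or.inr h]
    · rintro s hts hsT ω y (⟨rfl, hω, rfl⟩ | ⟨hs, ⟨p, hp, h⟩ | ⟨hω, h⟩⟩)
      · exact reach_subset _ _ _ (hx ω hω)
      · exact (hDP p hp).2.2.1 s hs hsT ω h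
      · exact (hDz _ (hrepL ω hω)).2.2.1 s hs hsT ω h
    · intro s hts ω ω' h
      have hL' : ω' ∈ L ↔ ω ∈ L := mem_level_iff_of_mem hts h
      ext y
      refine or_congr (by simp only [mem_ofPred_eq, hL']) (and_congr_right fun hs => or_congr ?_ ?_)
      · exact exists_congr fun p => and_congr_right fun hp => by
          rw [(hDP p hp).2.2.2.1 s hs ω ω' h]
      · rw [hL', hrepc ω ω' (level_antitone ψ ω hs h)]
        exact and_congr_right fun hω => by rw [(hDz _ (hrepL ω hω)).2.2.2.1 s hs ω ω' h]
    · intro Vhat hVhat ω hω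
      have hLω : level ψ t ω = L := level_eq_of_mem hω
      refine ⟨hVhat t le_rfl (by omega) ω hω (Or.inl ⟨rfl, hω, rfl⟩), c,
        (hCc t (by omega) ω₀ ω hω).symm ▸ hc, z (rep ω), ?_, ?_⟩
      · refine (hDz _ (hrepL ω hω)).2.2.2.2 Vhat (fun s hs hsT ω' h => ?_) ω
          (mem_level_symm (hrep ω))
        intro y hy
        have hω' : ω' ∈ level ψ (t + 1) ω := level_eq_of_mem (hrep ω) ▸ h
        refine hVhat s (by omega) hsT ω' (hsub ω hω hω') (Or.inr ⟨hs, Or.inr ⟨hsub ω hω hω', ?_⟩⟩)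
        rwa [hrepc ω ω' hω']
      · obtain ⟨m, hm, h⟩ := (hDz _ (hrepL ω hω)).1
        refine ⟨m, convexHull_mono ?_ hm, h⟩
        rw [hLω]
        intro p hp
        obtain ⟨hω₁, hD⟩ := hDP p hp
        refine mem_biUnion hω₁ (hD.2.2.2 Vhat (fun s hs hsT ω' h y hy => ?_) _
          (mem_level_self _ _ _))
        exact hVhat s (by omega) hsT ω' (hsub _ hω₁ h) (Or.inr ⟨hs, Or.inl ⟨p, hp, hy⟩⟩)

end SupportsReach

section LocalSolution

variable {Ω E F : Type*} [AddCommGroup F] [Module ℝ F]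

open Classical in
/-- The convex combination of finitely many finitely supported probability measures. -/
noncomputable def FinProb.mix (R : Finset Ω) (ν : Ω → ℝ) (hν : ∀ r ∈ R, 0 < ν r)
    (hν1 : ∑ r ∈ R, ν r = 1) (Q : Ω → FinProb Ω) : FinProb Ω where
  supp := R.biUnion fun r => (Q r).supp
  w := fun ω => ∑ r ∈ R, ν r * (Q r).w ω
  pos := fun ω hω => by
    obtain ⟨r, hr, h⟩ := Finset.mem_biUnion.1 hω
    exact Finset.sum_pos' (fun k hk => mul_nonneg (hν k hk).le ((Q k).nonneg ω))
      ⟨r, hr, mul_pos (hν r hr) ((Q r).pos ω h)⟩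
  zero := fun ω hω => Finset.sum_eq_zero fun r hr => by
    rw [(Q r).zero ω fun h => hω (Finset.mem_biUnion.2 ⟨r, hr, h⟩), mul_zero]
  sum_one := by
    rw [Finset.sum_comm, ← hν1]
    refine Finset.sum_congr rfl fun r hr => ?_
    rw [← Finset.mul_sum, ← Finset.sum_subset (Finset.subset_biUnion_of_mem _ hr)
      fun ω _ h => (Q r).zero ω h, (Q r).sum_one, mul_one]

theorem condExp_congr {ψ : ℕ → Ω → E} {t : ℕ} {Q Q' : FinProb Ω} {ξ ξ' : Ω → F} {ω : Ω} {a : ℝ}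
    (ha : a ≠ 0) (hQ : ∀ ω' ∈ level ψ t ω, Q.w ω' = a * Q'.w ω')
    (hξ : ∀ ω' ∈ level ψ t ω, ξ ω' = ξ' ω') : condExp ψ t Q ξ ω = condExp ψ t Q' ξ' ω := by
  classical
  have hsupp : Q.supp.filter (· ∈ level ψ t ω) = Q'.supp.filter (· ∈ level ψ t ω) := by
    ext ω'
    rw [Finset.mem_filter, Finset.mem_filter]
    refine and_congr_left fun h => ?_
    rw [Q.mem_supp_iff, Q'.mem_supp_iff, hQ ω' h, mul_ne_zero_iff_left ha]
  have h1 : ∑ ω' ∈ Q.supp.filter (· ∈ level ψ t ω), Q.w ω'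
      = a * ∑ ω' ∈ Q'.supp.filter (· ∈ level ψ t ω), Q'.w ω' := by
    rw [hsupp, Finset.mul_sum]
    exact Finset.sum_congr rfl fun ω' h => hQ ω' (Finset.mem_filter.1 h).2
  have h2 : ∑ ω' ∈ Q.supp.filter (· ∈ level ψ t ω), Q.w ω' • ξ ω'
      = a • ∑ ω' ∈ Q'.supp.filter (· ∈ level ψ t ω), Q'.w ω' • ξ' ω' := by
    rw [hsupp, Finset.smul_sum]
    refine Finset.sum_congr rfl fun ω' h => ?_
    rw [hQ ω' (Finset.mem_filter.1 h).2, hξ ω' (Finset.mem_filter.1 h).2, mul_smul]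
  have : condExp ψ t Q ξ ω = (∑ ω' ∈ Q.supp.filter (· ∈ level ψ t ω), Q.w ω')⁻¹ •
      ∑ ω' ∈ Q.supp.filter (· ∈ level ψ t ω), Q.w ω' • ξ ω' := by
    rw [condExp, FinProb.meas]
  rw [this, h1, h2, mul_inv, smul_smul, mul_right_comm, inv_mul_cancel₀ ha, one_mul,
    condExp, FinProb.meas]

theorem condExp_eq_sum {ψ : ℕ → Ω → E} {t : ℕ} {Q : FinProb Ω} {ξ : Ω → F} {ω : Ω}
    (h : ∀ ω' ∈ Q.supp, ω' ∈ level ψ t ω) :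
    condExp ψ t Q ξ ω = ∑ ω' ∈ Q.supp, Q.w ω' • ξ ω' := by
  unfold condExp FinProb.meas
  rw [@Finset.filter_true_of_mem _ _ (_) _ h, Q.sum_one, inv_one, one_smul]

theorem exists_local_solution {ψ : ℕ → Ω → E} {V C : ℕ → Ω → Set F} {T : ℕ}
    (hV : ∀ t ≤ T, ∀ ω, Convex ℝ (V t ω)) (hC : ∀ t ≤ T, ∀ ω, Convex ℝ (C t ω))
    (hVne : ∀ t ≤ T, ∀ ω, (V t ω).Nonempty)
    (hVc : ∀ t ≤ T, ∀ ω, ∀ ω' ∈ level ψ t ω, V t ω' = V t ω)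
    (hCc : ∀ t ≤ T, ∀ ω, ∀ ω' ∈ level ψ t ω, C t ω' = C t ω)
    {n t : ℕ} (hnt : n + t = T) {ω : Ω} {x : F} (hx : x ∈ reach ψ V C n t ω) :
    ∃ (Q : FinProb Ω) (ξ : ℕ → Ω → F), ω ∈ Q.supp ∧ (∀ ω' ∈ Q.supp, ω' ∈ level ψ t ω) ∧
      ξ t ω = x ∧
      (∀ s, t ≤ s → s ≤ T → ∀ ω', ξ s ω' ∈ V s ω' ∧ ∀ ω'' ∈ level ψ s ω', ξ s ω'' = ξ s ω') ∧
      ∀ s, t ≤ s → s + 1 ≤ T → ∀ ω' ∈ Q.supp,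
        condExp ψ s Q (ξ (s + 1)) ω' - ξ s ω' ∈ C s ω' := by
  classical
  have hf : ∀ s, ∃ f : Ω → F, s ≤ T →
      (∀ ω, f ω ∈ V s ω) ∧ ∀ ω, ∀ ω' ∈ level ψ s ω, f ω' = f ω := by
    intro s
    by_cases hs : s ≤ T
    · obtain ⟨f, h⟩ := exists_level_const_selection ψ s (hVc s hs) (hVne s hs)
      exact ⟨f, fun _ => h⟩
    · exact ⟨0, fun k => absurd k hs⟩
  choose f hf using hf
  induction n generalizing t ω x with
  | zero =>
    have htT : t ≤ T := by omega
    refine ⟨FinProb.dirac ω, fun s ω' => if ω' ∈ level ψ t ω then x else f s ω',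
      Finset.mem_singleton_self ω, fun ω' h => ?_, if_pos (mem_level_self ψ t ω),
      fun s hts hsT ω' => ⟨?_, fun ω'' h => ?_⟩, fun s hts hsT => by omega⟩
    · rw [Finset.mem_singleton.1 h]
      exact mem_level_self ψ t ω
    · obtain rfl : s = t := by omega
      change (if ω' ∈ level ψ s ω then x else f s ω') ∈ V s ω'
      split_ifs with h
      · rw [hVc s hsT ω ω' h]
        exact hx
      · exact (hf s hsT).1 ω'
    · simp only [mem_level_iff_of_mem hts h, (hf s hsT).2 ω' ω'' h]
  | succ n ih =>
    have htT : t ≤ T := by omega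
    obtain ⟨hxV, c, hc, ζ, hζ, m, hm, h⟩ := hx
    obtain ⟨R, ν, v, hωR, hRL, hRs, hν, hν1, hv, hsum⟩ :=
      exists_grouped_combination (G := reach ψ V C n (t + 1)) (L := level ψ t ω)
      (s := level ψ (t + 1)) (mem_level_self ψ (t + 1)) (fun _ _ => level_eq_of_mem)
      (fun ω ω' h _ hx _ hu => openSegment_subset_reach (hV _ (by omega) ω) (hC _ (by omega) ω) h
        (hVc _ (by omega) ω ω' h) (hCc _ (by omega) ω ω' h) hx hu)
      (mem_level_self ψ t ω) hζ hm h
    have hloc : ∀ r, ∃ (Q : FinProb Ω) (ξ : ℕ → Ω → F), r ∈ R → r ∈ Q.supp ∧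
        (∀ ω' ∈ Q.supp, ω' ∈ level ψ (t + 1) r) ∧ ξ (t + 1) r = v r ∧
        (∀ s, t + 1 ≤ s → s ≤ T → ∀ ω', ξ s ω' ∈ V s ω' ∧
          ∀ ω'' ∈ level ψ s ω', ξ s ω'' = ξ s ω') ∧
        ∀ s, t + 1 ≤ s → s + 1 ≤ T → ∀ ω' ∈ Q.supp,
          condExp ψ s Q (ξ (s + 1)) ω' - ξ s ω' ∈ C s ω' := by
      intro r
      by_cases hr : r ∈ R
      · obtain ⟨Q, ξ, h⟩ := ih (by omega) (hv r hr)
        exact ⟨Q, ξ, fun _ => h⟩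
      · exact ⟨FinProb.dirac r, 0, fun k => absurd k hr⟩
    choose Q ξ hQ using hloc
    have huniq : ∀ r ∈ R, ∀ r' ∈ R, ∀ ω' ∈ level ψ (t + 1) r, ω' ∈ level ψ (t + 1) r' →
        r' = r := fun r hr r' hr' ω' h h' =>
      hRs r hr r' hr' (level_eq_of_mem h ▸ mem_level_symm h')
    let P := FinProb.mix R ν hν hν1 Q
    have hPsupp : ∀ {ω'}, ω' ∈ P.supp ↔ ∃ r ∈ R, ω' ∈ (Q r).supp := Finset.mem_biUnion
    have hPw : ∀ r ∈ R, ∀ ω' ∈ level ψ (t + 1) r, P.w ω' = ν r * (Q r).w ω' := by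
      intro r hr ω' hω'
      refine Finset.sum_eq_single_of_mem r hr fun r' hr' hne => ?_
      rw [(Q r').zero ω' fun h => hne (huniq r hr r' hr' ω' hω' ((hQ r' hr').2.1 ω' h)), mul_zero]
    let η : ℕ → Ω → F := fun s ω' => if s = t then (if ω' ∈ level ψ t ω then x else f s ω') else
      if h : ∃ r ∈ R, ω' ∈ level ψ (t + 1) r then ξ h.choose s ω' else f s ω'
    have hηt : ∀ ω', η t ω' = if ω' ∈ level ψ t ω then x else f t ω' := fun ω' => if_pos rfl
    have hηr : ∀ s, t + 1 ≤ s → ∀ r ∈ R, ∀ ω' ∈ level ψ (t + 1) r, η s ω' = ξ r s ω' := by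
      intro s hs r hr ω' hω'
      have hex : ∃ r ∈ R, ω' ∈ level ψ (t + 1) r := ⟨r, hr, hω'⟩
      have : hex.choose = r := huniq r hr _ hex.choose_spec.1 ω' hω' hex.choose_spec.2
      simp only [η, if_neg (by omega : s ≠ t), dif_pos hex, this]
    have hηf : ∀ s, t + 1 ≤ s → ∀ ω', (¬ ∃ r ∈ R, ω' ∈ level ψ (t + 1) r) → η s ω' = f s ω' := by
      intro s hs ω' hω'
      simp only [η, if_neg (by omega : s ≠ t), dif_neg hω']
    have hPt : ∀ ω' ∈ P.supp, ω' ∈ level ψ t ω := by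
      intro ω' h
      obtain ⟨r, hr, h⟩ := hPsupp.1 h
      exact (mem_level_iff_of_mem t.le_succ ((hQ r hr).2.1 ω' h)).2 (hRL r hr)
    have hmean : ∑ ω' ∈ P.supp, P.w ω' • η (t + 1) ω' = x + c := by
      rw [← hsum]
      change ∑ ω' ∈ P.supp, (∑ r ∈ R, ν r * (Q r).w ω') • η (t + 1) ω' = _
      simp_rw [Finset.sum_smul]
      rw [Finset.sum_comm]
      refine Finset.sum_congr rfl fun r hr => ?_
      rw [← Finset.sum_subset (s₁ := (Q r).supp) fun ω' h => hPsupp.2 ⟨r, hr, h⟩]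
      · rw [← one_smul ℝ (v r), ← (Q r).sum_one, Finset.sum_smul, Finset.smul_sum]
        refine Finset.sum_congr rfl fun ω' h => ?_
        have hω' := (hQ r hr).2.1 ω' h
        rw [hηr _ le_rfl r hr ω' hω', ((hQ r hr).2.2.2.1 _ le_rfl (by omega) r).2 ω' hω',
          (hQ r hr).2.2.1, mul_smul]
      · intro ω' _ h
        rw [(Q r).zero ω' h, mul_zero, zero_smul]
    refine ⟨P, η, hPsupp.2 ⟨ω, hωR, (hQ ω hωR).1⟩, hPt,
      (hηt ω).trans (if_pos (mem_level_self ψ t ω)), fun s hts hsT ω' => ?_,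
      fun s hts hsT ω' hω' => ?_⟩
    · rcases hts.eq_or_lt with rfl | hs
      · refine ⟨?_, fun ω'' h => ?_⟩
        · rw [hηt]
          split_ifs with h
          · rw [hVc t htT ω ω' h]
            exact hxV
          · exact (hf t htT).1 ω'
        · rw [hηt, hηt]
          simp only [mem_level_iff_of_mem le_rfl h, (hf t htT).2 ω' ω'' h]
      · by_cases h : ∃ r ∈ R, ω' ∈ level ψ (t + 1) r
        · obtain ⟨r, hr, h⟩ := h
          obtain ⟨h1, h2⟩ := (hQ r hr).2.2.2.1 s hs hsT ω'
          rw [hηr s hs r hr ω' h]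
          refine ⟨h1, fun ω'' h'' => ?_⟩
          rw [hηr s hs r hr ω'' ((mem_level_iff_of_mem hs h'').2 h)]
          exact h2 ω'' h''
        · rw [hηf s hs ω' h]
          refine ⟨(hf s hsT).1 ω', fun ω'' h'' => ?_⟩
          rw [hηf s hs ω'' fun ⟨r, hr, k⟩ => h ⟨r, hr, (mem_level_iff_of_mem hs h'').1 k⟩]
          exact (hf s hsT).2 ω' ω'' h''
    · rcases hts.eq_or_lt with rfl | hs
      · have hω := hPt ω' hω'
        rw [condExp_eq_sum fun ω'' h => (level_eq_of_mem hω).symm ▸ hPt ω'' h, hmean, hηt,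
          if_pos hω, add_sub_cancel_left, hCc t htT ω ω' hω]
        exact hc
      · obtain ⟨r, hr, h⟩ := hPsupp.1 hω'
        have hr' := (hQ r hr).2.1 ω' h
        have hsub : ∀ ω'' ∈ level ψ s ω', ω'' ∈ level ψ (t + 1) r := fun ω'' h'' =>
          (mem_level_iff_of_mem hs h'').2 hr'
        rw [condExp_congr (hν r hr).ne' (fun ω'' h'' => hPw r hr ω'' (hsub ω'' h''))
          (fun ω'' h'' => hηr (s + 1) (by omega) r hr ω'' (hsub ω'' h'')), hηr s hs r hr ω' hr']
        exact (hQ r hr).2.2.2.2 s hs hsT ω' h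

end LocalSolution

section Polar

variable {d : ℕ}

theorem convex_intrinsicInterior_polar (B : Set (Fin d → ℝ)) :
    Convex ℝ (intrinsicInterior ℝ (polar B)) := by
  have h := (isClosedConvexCone_polar B).2.1
  exact h.intrinsicInterior_eq_algCore ▸ convex_algCore h

theorem nonempty_intrinsicInterior_polar (B : Set (Fin d → ℝ)) :
    (intrinsicInterior ℝ (polar B)).Nonempty :=
  have h := isClosedConvexCone_polar B
  Set.Nonempty.intrinsicInterior h.2.1 ⟨0, h.2.2.1⟩

end Polar

/-- Lemma 5.7: if the MSP `(ri K*, −A*)` is solvable, there is a dominating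
market `(K̂, A)` whose associated MSP is still solvable. -/
theorem msp_solvable_dominating_market
    {Ω E : Type*}
    [TopologicalSpace Ω] [PolishSpace Ω] [MeasurableSpace Ω] [BorelSpace Ω]
    [MetricSpace E] [TopologicalSpace.SeparableSpace E] [MeasurableSpace E] [BorelSpace E]
    (ψ : ℕ → Ω → E) (hψ : ∀ t, Measurable (ψ t)) (hψ0 : ∃ e : E, ∀ ω, ψ 0 ω = e)
    (d T : ℕ) (K A : ℕ → Ω → Set (Fin d → ℝ))
    (hKmeas : ∀ t ≤ T, CorrMeasurable (filt ψ t) (K t))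
    (hKcone : ∀ t ≤ T, ∀ ω : Ω, IsClosedConvexCone (K t ω))
    (hAmeas : ∀ t ≤ T, CorrMeasurable (filt ψ t) (A t))
    (hAcone : ∀ t ≤ T, ∀ ω : Ω, IsClosedConvexCone (A t ω))
    (hEF : AssumptionEF T K A) (hRO : AssumptionRO T K A)
    (hsolv : MSPSolvable ψ T (fun t ω => intrinsicInterior ℝ (polar (K t ω)))
      fun t ω => -polar (A t ω)) :
    ∃ Khat : ℕ → Ω → Set (Fin d → ℝ),
      (∀ t ≤ T, CorrMeasurable (filt ψ t) (Khat t)) ∧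
      (∀ t ≤ T, ∀ ω : Ω, IsClosedConvexCone (Khat t ω)) ∧
      MarketDominates T Khat K ∧
      MSPSolvable ψ T (fun t ω => intrinsicInterior ℝ (polar (Khat t ω)))
        fun t ω => -polar (A t ω) := by
  rcases isEmpty_or_nonempty Ω with hΩ | hΩ
  · exact ⟨K, hKmeas, hKcone, fun _ _ ω => isEmptyElim ω, fun ω => isEmptyElim ω⟩
  have hKc : ∀ t ≤ T, ∀ ω, ∀ ω' ∈ level ψ t ω, K t ω' = K t ω := fun t ht ω ω' h =>
    eq_of_corrMeasurable_filt (hKmeas t ht) (fun ω => (hKcone t ht ω).1) h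
  have hAc : ∀ t ≤ T, ∀ ω, ∀ ω' ∈ level ψ t ω, A t ω' = A t ω := fun t ht ω ω' h =>
    eq_of_corrMeasurable_filt (hAmeas t ht) (fun ω => (hAcone t ht ω).1) h
  set V : ℕ → Ω → Set (Fin d → ℝ) := fun t ω => intrinsicInterior ℝ (polar (K t ω)) with hVdef
  set C : ℕ → Ω → Set (Fin d → ℝ) := fun t ω => -polar (A t ω) with hCdef
  have hV : ∀ t ≤ T, ∀ ω, Convex ℝ (V t ω) := fun t _ ω => convex_intrinsicInterior_polar _
  have hC : ∀ t ≤ T, ∀ ω, Convex ℝ (C t ω) := fun t _ ω => (isClosedConvexCone_polar _).2.1.neg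
  have hVc : ∀ t ≤ T, ∀ ω, ∀ ω' ∈ level ψ t ω, V t ω' = V t ω := fun t ht ω ω' h => by
    simp only [hVdef, hKc t ht ω ω' h]
  have hCc : ∀ t ≤ T, ∀ ω, ∀ ω' ∈ level ψ t ω, C t ω' = C t ω := fun t ht ω ω' h => by
    simp only [hCdef, hAc t ht ω ω' h]
  have hlevel : ∀ ω ω', ω' ∈ level ψ 0 ω := by
    obtain ⟨e, he⟩ := hψ0
    intro ω ω' s hs
    rw [Nat.le_zero.1 hs, he, he]
  have habs : ∀ ω ω', ∀ x ∈ reach ψ V C T 0 ω, ∀ u ∈ reach ψ V C T 0 ω',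
      openSegment ℝ x u ⊆ reach ψ V C T 0 ω := fun ω ω' x hx u hu =>
    openSegment_subset_reach (hV 0 T.zero_le ω) (hC 0 T.zero_le ω) (hlevel ω ω')
      (hVc 0 T.zero_le ω ω' (hlevel ω ω')) (hCc 0 T.zero_le ω ω' (hlevel ω ω')) hx hu
  have hne : ∀ ω, (reach ψ V C T 0 ω).Nonempty := by
    intro ω
    obtain ⟨ξ, Q, hω, hξ, hQ⟩ := hsolv ω
    exact ⟨_, mem_reach_of_solution (fun s hs => (hξ s hs).2) hQ (add_zero T) hω⟩
  obtain ⟨x, hx⟩ : ∃ x, ∀ ω, x ∈ reach ψ V C T 0 ω := by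
    have hconv : Convex ℝ (⋃ ω, reach ψ V C T 0 ω) := by
      refine convex_iff_openSegment_subset.2 fun u hu v hv => ?_
      obtain ⟨ω, hu⟩ := mem_iUnion.1 hu
      obtain ⟨ω', hv⟩ := mem_iUnion.1 hv
      exact (habs ω ω' u hu v hv).trans (subset_iUnion _ ω)
    obtain ⟨ω₀⟩ := hΩ
    obtain ⟨u, hu⟩ := hne ω₀
    obtain ⟨x, hx⟩ := algCore_nonempty hconv ⟨u, mem_iUnion.2 ⟨ω₀, hu⟩⟩
    refine ⟨x, fun ω => ?_⟩
    obtain ⟨ζ, hζ⟩ := hne ω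
    obtain ⟨y, hy, h⟩ := exists_mem_openSegment_of_mem_algCore hx (mem_iUnion.2 ⟨ω, hζ⟩)
    obtain ⟨ω', hy⟩ := mem_iUnion.1 hy
    exact habs ω ω' ζ hζ y hy h
  obtain ⟨ω₀⟩ := hΩ
  obtain ⟨D, hDfin, hDV, hDc, hD⟩ := exists_supportsReach hV hC hVc hCc (add_zero T) (ω₀ := ω₀)
    fun ω _ => hx ω
  have hdom : ∀ K₀ D₀ : Set (Fin d → ℝ), ∃ Khat, IsClosedConvexCone K₀ → D₀.Finite →
      D₀ ⊆ intrinsicInterior ℝ (polar K₀) → IsClosedConvexCone Khat ∧ ConeDominates K₀ Khat ∧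
        D₀ ⊆ intrinsicInterior ℝ (polar Khat) := fun K₀ D₀ => by
    by_cases h : IsClosedConvexCone K₀ ∧ D₀.Finite ∧ D₀ ⊆ intrinsicInterior ℝ (polar K₀)
    · obtain ⟨Khat, hKhat⟩ := exists_coneDominates h.1 h.2.1 h.2.2
      exact ⟨Khat, fun _ _ _ => hKhat⟩
    · exact ⟨∅, fun h1 h2 h3 => absurd ⟨h1, h2, h3⟩ h⟩
  choose Φ hΦ using hdom
  have hΦKD := fun t (ht : t ≤ T) ω =>
    hΦ (K t ω) (D t ω) (hKcone t ht ω) (hDfin t ω) (hDV t t.zero_le ht ω)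
  have hΦc : ∀ t ≤ T, ∀ ω, ∀ ω' ∈ level ψ t ω,
      Φ (K t ω') (D t ω') = Φ (K t ω) (D t ω) := fun t ht ω ω' h => by
    rw [hKc t ht ω ω' h, hDc t t.zero_le ω ω' h]
  refine ⟨fun t ω => Φ (K t ω) (D t ω), fun t ht => corrMeasurable_filt_of_const (hΦc t ht),
    fun t ht ω => (hΦKD t ht ω).1, fun t ht ω => (hΦKD t ht ω).2.1, fun ωb => ?_⟩
  obtain ⟨Q, ξ, hω, -, -, hξ, hQ⟩ := exists_local_solution
    (fun t _ ω => convex_intrinsicInterior_polar (Φ (K t ω) (D t ω))) hC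
    (fun t _ ω => nonempty_intrinsicInterior_polar _)
    (fun t ht ω ω' h => by rw [hΦc t ht ω ω' h]) hCc (add_zero T)
    (hD _ (fun t _ ht ω _ => (hΦKD t ht ω).2.2) ωb (hlevel ω₀ ωb))
  refine ⟨ξ, Q, hω, fun t ht => ⟨fun B _ => measurableSet_filt_of_saturated fun ω h ω' h' => ?_,
    fun ω => (hξ t t.zero_le ht ω).1⟩, fun t ht => hQ t t.zero_le ht⟩
  rw [mem_preimage, (hξ t t.zero_le ht ω).2 ω' h']
  exact h

end MSPPaper
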